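/- arXiv:2504.19769 — 4 statements merged into one kernel-verified Lean document; each statement's English description precedes it below -/
import Mathlib

section
/- Let p, q ∈ ℕ. There exist a constant C > 0 and finitely many pairs (m₁, n₁), …, (m_N, n_N) of natural numbers such that for every φ ∈ S(ℝ): sup_{x∈ℝ} |(d/dx)^p((1+x²)^q φ(x))| ≤ C Σ_{i=1}^N ‖(1+x²)^{m_i} Λ_{k,M⁻¹}^{n_i} φ‖_{L^2_k}. Consequently, the family of seminorms φ ↦ ‖(1+x²)^m Λ_{k,M⁻¹}ⁿ φ‖_{L^2_k} (m, n ∈ ℕ) generates the standard topology of S(ℝ). -/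
open MeasureTheory Filter Complex Topology
open scoped ENNReal

noncomputable section

/-- The measure `μ_k` on `ℝ`: `dμ_k(x) = |x|^(2k+1) dx / (2^(k+1) Γ(k+1))`. -/
def muK (k : ℝ) : Measure ℝ :=
  MeasureTheory.volume.withDensity
    (fun x : ℝ => ENNReal.ofReal (|x| ^ (2 * k + 1) / (2 ^ (k + 1) * Real.Gamma (k + 1))))

/-- The normalized Bessel function `j_k`. -/
def besselJ (k x : ℝ) : ℝ :=
  Real.Gamma (k + 1) *
    ∑' n : ℕ, (-1 : ℝ) ^ n * (x / 2) ^ (2 * n) / ((n.factorial : ℝ) * Real.Gamma ((n : ℝ) + k + 1))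

/-- The Dunkl kernel `E_k(iλ, x)`. -/
def dunklKernel (k lam x : ℝ) : ℂ :=
  (besselJ k (lam * x) : ℂ) +
    Complex.I * (lam : ℂ) * (x : ℂ) / (2 * ((k : ℂ) + 1)) * (besselJ (k + 1) (lam * x) : ℂ)

/-- The Dunkl transform `D_k f`. -/
def dunklT (k : ℝ) (f : ℝ → ℂ) (lam : ℝ) : ℂ :=
  ∫ x : ℝ, f x * dunklKernel k (-lam) x ∂(muK k)

/-- The linear canonical Dunkl transform `D_k^M` for `M = (a, b; c, d)`. -/
def lcdt (k a b d : ℝ) (f : ℝ → ℂ) (lam : ℝ) : ℂ :=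
  ((Complex.I * (b : ℂ)) ^ ((k : ℂ) + 1))⁻¹ *
    ∫ x : ℝ, f x *
      Complex.exp (Complex.I / 2 * (((d / b : ℝ) : ℂ) * (lam : ℂ) ^ 2 + ((a / b : ℝ) : ℂ) * (x : ℂ) ^ 2)) *
      dunklKernel k (-lam / b) x ∂(muK k)

/-- The Dunkl operator `Λ_k`. -/
def dunklOp (k : ℝ) (f : ℝ → ℂ) : ℝ → ℂ := fun x =>
  if x = 0 then (2 * (k : ℂ) + 2) * deriv f 0
  else deriv f x + (((2 * k + 1) / x : ℝ) : ℂ) * ((f x - f (-x)) / 2)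

/-- The linear canonical Dunkl operator `Λ_{k,M⁻¹} f(x) = Λ_k f(x) + i (a/b) x f(x)`. -/
def lcdOp (k a b : ℝ) (f : ℝ → ℂ) : ℝ → ℂ := fun x =>
  dunklOp k f x + Complex.I * ((a / b : ℝ) : ℂ) * (x : ℂ) * f x

/-- The linear canonical Dunkl operator `Λ_{k,M} f(x) = Λ_k f(x) - i (d/b) x f(x)`. -/
def lcdOpM (k d b : ℝ) (f : ℝ → ℂ) : ℝ → ℂ := fun x =>
  dunklOp k f x - Complex.I * ((d / b : ℝ) : ℂ) * (x : ℂ) * f x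

/-- The linear canonical Dunkl Laplacian `Δ_{k,M⁻¹} = Λ_{k,M⁻¹} ∘ Λ_{k,M⁻¹}`. -/
def deltaOp (k a b : ℝ) : (ℝ → ℂ) → ℝ → ℂ := fun f => lcdOp k a b (lcdOp k a b f)

/-- The operator `i Λ_{k,M⁻¹}`. -/
def iLam (k a b : ℝ) : (ℝ → ℂ) → ℝ → ℂ := fun f x => Complex.I * lcdOp k a b f x

/-- The operator `P(i Λ_{k,M⁻¹}) = Σ_j c_j (iΛ_{k,M⁻¹})^j` for `P(t) = Σ_j c_j t^j`. -/
def polyOpI (k a b : ℝ) (P : Polynomial ℝ) : (ℝ → ℂ) → ℝ → ℂ := fun f x =>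
  ∑ j ∈ Finset.range (P.natDegree + 1), ((P.coeff j : ℝ) : ℂ) * (iLam k a b)^[j] f x

end

/-- Averaging a Schwartz function along segments from the origin may be differentiated under the
integral sign. -/
lemma hasDerivAt_integral_dilation (c : ℕ) (h : SchwartzMap ℝ ℂ) (x : ℝ) :
    HasDerivAt (fun y : ℝ => ∫ s in (0 : ℝ)..1, ((s ^ c : ℝ) : ℂ) * h (s * y))
      (∫ s in (0 : ℝ)..1, ((s ^ (c + 1) : ℝ) : ℂ) * SchwartzMap.derivCLM ℂ ℂ h (s * x)) x := by
  obtain ⟨B, hB⟩ : ∃ B, ∀ y, ‖SchwartzMap.derivCLM ℂ ℂ h y‖ ≤ B :=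
    ⟨_, fun y => SchwartzMap.norm_le_seminorm ℝ _ y⟩
  have hc : Continuous h := h.continuous
  have hc' : Continuous (SchwartzMap.derivCLM ℂ ℂ h) := (SchwartzMap.derivCLM ℂ ℂ h).continuous
  refine (intervalIntegral.hasDerivAt_integral_of_dominated_loc_of_deriv_le (bound := fun _ => B)
    (F := fun (y s : ℝ) => ((s ^ c : ℝ) : ℂ) * h (s * y))
    (F' := fun (y s : ℝ) => ((s ^ (c + 1) : ℝ) : ℂ) * SchwartzMap.derivCLM ℂ ℂ h (s * y))
    Filter.univ_mem (Filter.Eventually.of_forall fun y => ?_) ?_ ?_ ?_ ?_ ?_).2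
  · exact Continuous.aestronglyMeasurable (by fun_prop)
  · exact Continuous.intervalIntegrable (by fun_prop) _ _
  · exact Continuous.aestronglyMeasurable (by fun_prop)
  · refine Filter.Eventually.of_forall fun s hs y _ => ?_
    rw [Set.uIoc_of_le zero_le_one] at hs
    rw [norm_mul, Complex.norm_real, norm_pow, Real.norm_eq_abs, abs_of_pos hs.1]
    exact (mul_le_of_le_one_left (norm_nonneg _) (pow_le_one₀ hs.1.le hs.2)).trans (hB _)
  · exact continuous_const.intervalIntegrable _ _
  · refine Filter.Eventually.of_forall fun s _ y _ => ?_
    have h1 : HasDerivAt (fun y : ℝ => h (s * y))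
        (s • SchwartzMap.derivCLM ℂ ℂ h (s * y)) y := by
      have := (h.hasDerivAt (s * y)).scomp y ((hasDerivAt_id y).const_mul s)
      simpa [Function.comp_def] using this
    have h2 := h1.const_mul ((s ^ c : ℝ) : ℂ)
    refine h2.congr_deriv ?_
    rw [Complex.real_smul]
    push_cast
    ring

lemma contDiff_integral_dilation (n c : ℕ) (h : SchwartzMap ℝ ℂ) :
    ContDiff ℝ n (fun y : ℝ => ∫ s in (0 : ℝ)..1, ((s ^ c : ℝ) : ℂ) * h (s * y)) := by
  induction n generalizing c h with
  | zero =>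
    exact contDiff_zero.2
      (continuous_iff_continuousAt.2 fun x => (hasDerivAt_integral_dilation c h x).continuousAt)
  | succ n ih =>
    rw [Nat.cast_succ, contDiff_succ_iff_deriv]
    refine ⟨fun x => (hasDerivAt_integral_dilation c h x).differentiableAt, by simp, ?_⟩
    rw [show deriv (fun y : ℝ => ∫ s in (0 : ℝ)..1, ((s ^ c : ℝ) : ℂ) * h (s * y)) = _ from
      funext fun x => (hasDerivAt_integral_dilation c h x).deriv]
    exact ih _ _

/-- A continuous function `g` decays rapidly as soon as `x ↦ x * g x` does. -/
lemma exists_pow_mul_norm_le_of_mul {g : ℝ → ℂ} (hg : Continuous g)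
    (hx : ∀ l : ℕ, ∃ C, ∀ x : ℝ, |x| ^ l * ‖(x : ℂ) * g x‖ ≤ C) (l : ℕ) :
    ∃ C, ∀ x : ℝ, |x| ^ l * ‖g x‖ ≤ C := by
  obtain ⟨B, hB⟩ := isCompact_Icc.exists_bound_of_continuousOn (s := Set.Icc (-1 : ℝ) 1)
    hg.continuousOn
  obtain ⟨C, hC⟩ := hx l
  refine ⟨max B C, fun x => ?_⟩
  rcases le_total |x| 1 with h | h
  · exact ((mul_le_of_le_one_left (norm_nonneg _) (pow_le_one₀ (abs_nonneg _) h)).trans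
      (hB x (abs_le.1 h))).trans (le_max_left _ _)
  · refine (le_trans ?_ (hC x)).trans (le_max_right _ _)
    rw [norm_mul, Complex.norm_real, Real.norm_eq_abs]
    gcongr
    exact le_mul_of_one_le_left (norm_nonneg _) h

/-- Differentiating `x * g x = f x` repeatedly. -/
lemma mul_iteratedDeriv_succ_of_mul_eq {f g : ℝ → ℂ} (hf : ContDiff ℝ (⊤ : ℕ∞) f)
    (hg : ContDiff ℝ (⊤ : ℕ∞) g) (hfg : ∀ x : ℝ, (x : ℂ) * g x = f x) (n : ℕ) (x : ℝ) :
    (x : ℂ) * iteratedDeriv (n + 1) g x =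
      iteratedDeriv (n + 1) f x - (n + 1) * iteratedDeriv n g x := by
  have hd : ∀ {u : ℝ → ℂ}, ContDiff ℝ (⊤ : ℕ∞) u → ∀ (m : ℕ) (y : ℝ),
      HasDerivAt (iteratedDeriv m u) (iteratedDeriv (m + 1) u y) y := by
    intro u hu m y
    rw [iteratedDeriv_succ]
    exact ((hu.differentiable_iteratedDeriv m (by exact_mod_cast ENat.natCast_lt_top m)) y).hasDerivAt
  have hid : ∀ y : ℝ, HasDerivAt (fun t : ℝ => (t : ℂ)) 1 y := fun y => Complex.ofRealCLM.hasDerivAt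
  induction n generalizing x with
  | zero =>
    have h1 := (hid x).mul (hd hg 0 x)
    have h2 := hd hf 0 x
    simp only [iteratedDeriv_zero] at h1 h2
    have h3 : HasDerivAt f _ x := h1.congr_of_eventuallyEq (.of_forall fun y => (hfg y).symm)
    have := h3.unique h2
    simp only [iteratedDeriv_zero]
    rw [← this]
    push_cast
    ring
  | succ n ih =>
    have h1 := (hid x).mul (hd hg (n + 1) x)
    have h2 := (hd hf (n + 1) x).sub ((hd hg n x).const_mul ((n : ℂ) + 1))
    have h3 := h1.congr_of_eventuallyEq (f₁ := fun y => iteratedDeriv (n + 1) f y -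
      ((n : ℂ) + 1) * iteratedDeriv n g y) (.of_forall fun y => (ih y).symm)
    have := h3.unique h2
    push_cast
    linear_combination this

/-- A smooth function `g` is Schwartz as soon as `x ↦ x * g x` is. -/
lemma exists_schwartzMap_eq_of_mul_eq {g : ℝ → ℂ} (hg : ContDiff ℝ (⊤ : ℕ∞) g)
    (f : SchwartzMap ℝ ℂ) (hfg : ∀ x : ℝ, (x : ℂ) * g x = f x) :
    ∃ G : SchwartzMap ℝ ℂ, ∀ x, G x = g x := by
  have key : ∀ n l : ℕ, ∃ C, ∀ x : ℝ, |x| ^ l * ‖iteratedDeriv n g x‖ ≤ C := by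
    have hf : ∀ n l : ℕ, ∃ C, ∀ x : ℝ, |x| ^ l * ‖iteratedDeriv n f x‖ ≤ C := fun n l =>
      ⟨_, fun x => SchwartzMap.le_seminorm' ℝ l n f x⟩
    intro n
    induction n with
    | zero =>
      refine exists_pow_mul_norm_le_of_mul (by simpa using hg.continuous) fun l => ?_
      simpa [hfg] using hf 0 l
    | succ n ih =>
      refine exists_pow_mul_norm_le_of_mul
        (hg.continuous_iteratedDeriv _ (by exact_mod_cast le_top)) fun l => ?_
      obtain ⟨C, hC⟩ := hf (n + 1) l
      obtain ⟨C', hC'⟩ := ih l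
      refine ⟨C + (n + 1) * C', fun x => ?_⟩
      rw [mul_iteratedDeriv_succ_of_mul_eq (f.smooth ⊤) hg hfg]
      calc |x| ^ l * ‖iteratedDeriv (n + 1) f x - (n + 1) * iteratedDeriv n g x‖
          ≤ |x| ^ l * (‖iteratedDeriv (n + 1) f x‖ + (n + 1) * ‖iteratedDeriv n g x‖) := by
            gcongr
            refine (norm_sub_le _ _).trans (le_of_eq ?_)
            rw [norm_mul]
            norm_cast
        _ = |x| ^ l * ‖iteratedDeriv (n + 1) f x‖
            + (n + 1) * (|x| ^ l * ‖iteratedDeriv n g x‖) := by ring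
        _ ≤ C + (n + 1) * C' := by
            gcongr
            · exact hC x
            · exact hC' x
  refine ⟨⟨g, hg, fun l n => ?_⟩, fun x => rfl⟩
  obtain ⟨C, hC⟩ := key n l
  exact ⟨C, fun x => by rw [norm_iteratedFDeriv_eq_norm_iteratedDeriv]; exact hC x⟩

/-- A Schwartz function vanishing at the origin is divisible by `x` in the Schwartz space. -/
lemma exists_schwartzMap_mul_eq (f : SchwartzMap ℝ ℂ) (hf : f 0 = 0) :
    ∃ G : SchwartzMap ℝ ℂ, ∀ x : ℝ, (x : ℂ) * G x = f x := by
  have hmul : ∀ x : ℝ, (x : ℂ) * (∫ s in (0 : ℝ)..1, ((s ^ 0 : ℝ) : ℂ) *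
      SchwartzMap.derivCLM ℂ ℂ f (s * x)) = f x := by
    intro x
    rw [← intervalIntegral.integral_const_mul]
    have hd : ∀ s ∈ Set.uIcc (0 : ℝ) 1, HasDerivAt (fun s : ℝ => f (s * x))
        ((x : ℂ) * (((s ^ 0 : ℝ) : ℂ) * SchwartzMap.derivCLM ℂ ℂ f (s * x))) s := by
      intro s _
      have := (f.hasDerivAt (s * x)).scomp s ((hasDerivAt_id s).mul_const x)
      simpa [Function.comp_def] using this
    have hc' : Continuous (SchwartzMap.derivCLM ℂ ℂ f) := (SchwartzMap.derivCLM ℂ ℂ f).continuous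
    rw [intervalIntegral.integral_eq_sub_of_hasDerivAt hd
      (Continuous.intervalIntegrable (by fun_prop) _ _)]
    simp [hf]
  obtain ⟨G, hG⟩ := exists_schwartzMap_eq_of_mul_eq
    (contDiff_infty.2 fun n => contDiff_integral_dilation n 0 (SchwartzMap.derivCLM ℂ ℂ f)) f hmul
  exact ⟨G, fun x => by rw [hG, hmul]⟩

/-- The derivative as an operator on the Schwartz space. -/
noncomputable def schwartzD : SchwartzMap ℝ ℂ →L[ℂ] SchwartzMap ℝ ℂ := SchwartzMap.derivCLM ℂ ℂ

/-- Multiplication by the coordinate as an operator on the Schwartz space. -/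
noncomputable def schwartzX : SchwartzMap ℝ ℂ →L[ℂ] SchwartzMap ℝ ℂ :=
  SchwartzMap.smulLeftCLM ℂ (fun x : ℝ => (x : ℂ))

/-- The reflection `f ↦ f(-·)` as an operator on the Schwartz space. -/
noncomputable def schwartzRefl : SchwartzMap ℝ ℂ →L[ℂ] SchwartzMap ℝ ℂ :=
  SchwartzMap.compCLMOfContinuousLinearEquiv ℂ (ContinuousLinearEquiv.neg ℝ)

lemma schwartzD_apply (f : SchwartzMap ℝ ℂ) (x : ℝ) : schwartzD f x = deriv f x := rfl

lemma schwartzX_apply (f : SchwartzMap ℝ ℂ) (x : ℝ) : schwartzX f x = (x : ℂ) * f x := by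
  rw [schwartzX, SchwartzMap.smulLeftCLM_apply_apply (by fun_prop), smul_eq_mul]

lemma schwartzRefl_apply (f : SchwartzMap ℝ ℂ) (x : ℝ) : schwartzRefl f x = f (-x) := by
  simp [schwartzRefl]

lemma schwartzD_hasDerivAt (f : SchwartzMap ℝ ℂ) (x : ℝ) : HasDerivAt f (schwartzD f x) x :=
  f.hasDerivAt x

lemma schwartzD_iterate_apply (n : ℕ) (f : SchwartzMap ℝ ℂ) (x : ℝ) :
    schwartzD^[n] f x = iteratedDeriv n f x := by
  induction n generalizing x with
  | zero => simp
  | succ n ih =>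
    rw [Function.iterate_succ_apply', schwartzD_apply, iteratedDeriv_succ]
    congr 1
    exact funext ih

lemma schwartzD_schwartzX (f : SchwartzMap ℝ ℂ) :
    schwartzD (schwartzX f) = schwartzX (schwartzD f) + f := by
  ext x
  have h := (Complex.ofRealCLM.hasDerivAt (x := x)).mul (schwartzD_hasDerivAt f x)
  have h' : HasDerivAt (schwartzX f) _ x :=
    h.congr_of_eventuallyEq (.of_forall fun y => schwartzX_apply f y)
  rw [(schwartzD_hasDerivAt _ x).unique h', add_apply, schwartzX_apply]
  simp [add_comm]

lemma schwartzD_schwartzRefl (f : SchwartzMap ℝ ℂ) :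
    schwartzD (schwartzRefl f) = -schwartzRefl (schwartzD f) := by
  ext x
  have h := (schwartzD_hasDerivAt f (-x)).scomp x (hasDerivAt_neg x)
  have h' : HasDerivAt (schwartzRefl f) _ x :=
    h.congr_of_eventuallyEq (.of_forall fun y => schwartzRefl_apply f y)
  rw [(schwartzD_hasDerivAt _ x).unique h', neg_apply, schwartzRefl_apply]
  simp

lemma schwartzX_schwartzRefl (f : SchwartzMap ℝ ℂ) :
    schwartzX (schwartzRefl f) = -schwartzRefl (schwartzX f) := by
  ext x
  simp [schwartzX_apply, schwartzRefl_apply]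

lemma schwartzRefl_schwartzRefl (f : SchwartzMap ℝ ℂ) : schwartzRefl (schwartzRefl f) = f := by
  ext x
  simp [schwartzRefl_apply]

lemma schwartzX_injective {f g : SchwartzMap ℝ ℂ} (h : schwartzX f = schwartzX g) : f = g := by
  have h0 : Set.EqOn f g {0}ᶜ := by
    intro x hx
    have := congrArg (fun u : SchwartzMap ℝ ℂ => u x) h
    simp only [schwartzX_apply] at this
    exact mul_left_cancel₀ (by exact_mod_cast hx) this
  exact DFunLike.coe_injective
    (Continuous.ext_on (dense_compl_singleton (0 : ℝ)) f.continuous g.continuous h0)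

lemma smul_sub_schwartzRefl_zero (f : SchwartzMap ℝ ℂ) :
    ((1 / 2 : ℂ) • (f - schwartzRefl f)) 0 = 0 := by
  simp [schwartzRefl_apply]

/-- The difference quotient `f ↦ (f(x) - f(-x)) / (2x)` on the Schwartz space. -/
noncomputable def schwartzR (f : SchwartzMap ℝ ℂ) : SchwartzMap ℝ ℂ :=
  Classical.choose (exists_schwartzMap_mul_eq _ (smul_sub_schwartzRefl_zero f))

lemma schwartzX_schwartzR (f : SchwartzMap ℝ ℂ) :
    schwartzX (schwartzR f) = (1 / 2 : ℂ) • (f - schwartzRefl f) := by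
  ext x
  rw [schwartzX_apply]
  exact Classical.choose_spec (exists_schwartzMap_mul_eq _ (smul_sub_schwartzRefl_zero f)) x

lemma schwartzR_add (f g : SchwartzMap ℝ ℂ) : schwartzR (f + g) = schwartzR f + schwartzR g := by
  apply schwartzX_injective
  simp only [map_add, schwartzX_schwartzR]
  module

lemma schwartzR_smul (z : ℂ) (f : SchwartzMap ℝ ℂ) : schwartzR (z • f) = z • schwartzR f := by
  apply schwartzX_injective
  simp only [map_smul, schwartzX_schwartzR]
  module

lemma schwartzR_schwartzRefl (f : SchwartzMap ℝ ℂ) :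
    schwartzR (schwartzRefl f) = -schwartzR f := by
  apply schwartzX_injective
  simp only [map_neg, schwartzX_schwartzR, schwartzRefl_schwartzRefl]
  module

lemma schwartzRefl_schwartzR (f : SchwartzMap ℝ ℂ) :
    schwartzRefl (schwartzR f) = schwartzR f := by
  apply schwartzX_injective
  simp only [schwartzX_schwartzRefl, map_smul, map_sub, schwartzX_schwartzR,
    schwartzRefl_schwartzRefl]
  module

lemma schwartzR_schwartzX (f : SchwartzMap ℝ ℂ) :
    schwartzR (schwartzX f) = (1 / 2 : ℂ) • (f + schwartzRefl f) := by
  apply schwartzX_injective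
  simp only [map_smul, map_add, schwartzX_schwartzR, schwartzX_schwartzRefl]
  module

lemma schwartzX_schwartzD_schwartzR (f : SchwartzMap ℝ ℂ) :
    schwartzX (schwartzD (schwartzR f)) + schwartzR f =
      (1 / 2 : ℂ) • (schwartzD f + schwartzRefl (schwartzD f)) := by
  rw [← schwartzD_schwartzX, schwartzX_schwartzR, map_smul, map_sub, schwartzD_schwartzRefl]
  module

/-- The Dunkl operator on the Schwartz space. -/
noncomputable def schwartzDunkl (k : ℝ) (f : SchwartzMap ℝ ℂ) : SchwartzMap ℝ ℂ :=
  schwartzD f + (2 * k + 1 : ℂ) • schwartzR f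

/-- The linear canonical Dunkl operator on the Schwartz space. -/
noncomputable def schwartzLcd (k a b : ℝ) (f : SchwartzMap ℝ ℂ) : SchwartzMap ℝ ℂ :=
  schwartzDunkl k f + (Complex.I * ((a / b : ℝ) : ℂ)) • schwartzX f

lemma coe_schwartzDunkl (k : ℝ) (f : SchwartzMap ℝ ℂ) : dunklOp k f = schwartzDunkl k f := by
  ext x
  rw [schwartzDunkl, add_apply, smul_apply, schwartzD_apply, dunklOp,
    smul_eq_mul]
  split_ifs with hx
  · subst hx
    have h := congrArg (fun u : SchwartzMap ℝ ℂ => u 0) (schwartzX_schwartzD_schwartzR f)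
    simp [schwartzX_apply, schwartzRefl_apply, schwartzD_apply] at h
    rw [h]
    ring
  · have h := congrArg (fun u : SchwartzMap ℝ ℂ => u x) (schwartzX_schwartzR f)
    simp [schwartzX_apply, schwartzRefl_apply] at h
    have hx' : (x : ℂ) ≠ 0 := by exact_mod_cast hx
    rw [eq_comm, ← mul_right_inj' hx', mul_add, mul_left_comm, h]
    push_cast
    field_simp

lemma coe_schwartzLcd (k a b : ℝ) (f : SchwartzMap ℝ ℂ) : lcdOp k a b f = schwartzLcd k a b f := by
  ext x
  rw [schwartzLcd, add_apply, smul_apply, schwartzX_apply, lcdOp,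
    coe_schwartzDunkl, smul_eq_mul]
  ring

lemma coe_schwartzLcd_iterate (k a b : ℝ) (n : ℕ) (f : SchwartzMap ℝ ℂ) :
    (lcdOp k a b)^[n] f = (schwartzLcd k a b)^[n] f := by
  induction n with
  | zero => rfl
  | succ n ih => rw [Function.iterate_succ_apply', Function.iterate_succ_apply', ih, coe_schwartzLcd]

lemma schwartzDunkl_add (k : ℝ) (f g : SchwartzMap ℝ ℂ) :
    schwartzDunkl k (f + g) = schwartzDunkl k f + schwartzDunkl k g := by
  simp only [schwartzDunkl, map_add, schwartzR_add]
  module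

lemma schwartzDunkl_smul (k : ℝ) (z : ℂ) (f : SchwartzMap ℝ ℂ) :
    schwartzDunkl k (z • f) = z • schwartzDunkl k f := by
  simp only [schwartzDunkl, map_smul, schwartzR_smul]
  module

lemma schwartzDunkl_schwartzRefl (k : ℝ) (f : SchwartzMap ℝ ℂ) :
    schwartzDunkl k (schwartzRefl f) = -schwartzRefl (schwartzDunkl k f) := by
  simp only [schwartzDunkl, map_smul, map_add, schwartzR_schwartzRefl, schwartzRefl_schwartzR,
    schwartzD_schwartzRefl]
  module

lemma schwartzDunkl_schwartzX (k : ℝ) (f : SchwartzMap ℝ ℂ) :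
    schwartzDunkl k (schwartzX f) =
      schwartzX (schwartzDunkl k f) + f + (2 * k + 1 : ℂ) • schwartzRefl f := by
  simp only [schwartzDunkl, map_smul, map_add, schwartzR_schwartzX, schwartzX_schwartzR,
    schwartzD_schwartzX]
  module

/-- The even part of the Dunkl operator, expressed through the difference quotient. -/
lemma schwartzDunkl_add_schwartzRefl (k : ℝ) (f : SchwartzMap ℝ ℂ) :
    (1 / 2 : ℂ) • (schwartzDunkl k f + schwartzRefl (schwartzDunkl k f)) =
      schwartzX (schwartzD (schwartzR f)) + (2 * k + 2 : ℂ) • schwartzR f := by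
  have h := schwartzX_schwartzD_schwartzR f
  rw [← eq_sub_iff_add_eq] at h
  simp only [schwartzDunkl, map_smul, map_add, schwartzRefl_schwartzR, h]
  module

/-- The squared norm of a Schwartz function in `L²(|x|^γ dx)`. -/
noncomputable def weightedSq (γ : ℝ) (f : SchwartzMap ℝ ℂ) : ℝ := ∫ x : ℝ, |x| ^ γ * ‖f x‖ ^ 2

lemma abs_rpow_le_one_add_pow {γ : ℝ} (hγ : 0 ≤ γ) {n : ℕ} (hn : γ ≤ n) (x : ℝ) :
    |x| ^ γ ≤ 1 + |x| ^ n := by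
  rcases le_total |x| 1 with h | h
  · exact (Real.rpow_le_one (abs_nonneg _) h hγ).trans (by simp)
  · refine le_trans ?_ (le_add_of_nonneg_left zero_le_one)
    rw [← Real.rpow_natCast]
    exact Real.rpow_le_rpow_of_exponent_le h hn

lemma continuous_abs_rpow {γ : ℝ} (hγ : 0 ≤ γ) : Continuous fun x : ℝ => |x| ^ γ :=
  continuous_abs.rpow_const fun _ => Or.inr hγ

lemma integrable_abs_rpow_mul {γ : ℝ} (hγ : 0 ≤ γ) (f g : SchwartzMap ℝ ℂ) :
    Integrable fun x : ℝ => |x| ^ γ * (‖f x‖ * ‖g x‖) := by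
  obtain ⟨n, hn⟩ := exists_nat_ge γ
  have hf : ∀ x, ‖f x‖ ≤ _ := SchwartzMap.norm_le_seminorm ℝ f
  refine (((g.integrable_pow_mul volume 0).add (g.integrable_pow_mul volume n)).const_mul
    (SchwartzMap.seminorm ℝ 0 0 f)).mono' (Continuous.aestronglyMeasurable ?_)
    (.of_forall fun x => ?_)
  · exact (continuous_abs_rpow hγ).mul (f.continuous.norm.mul g.continuous.norm)
  · rw [Real.norm_of_nonneg (by positivity)]
    calc |x| ^ γ * (‖f x‖ * ‖g x‖)
        ≤ (1 + |x| ^ n) * (SchwartzMap.seminorm ℝ 0 0 f * ‖g x‖) := by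
          gcongr
          · exact abs_rpow_le_one_add_pow hγ hn x
          · exact hf x
      _ = _ := by simp; ring

lemma integrable_weightedSq {γ : ℝ} (hγ : 0 ≤ γ) (f : SchwartzMap ℝ ℂ) :
    Integrable fun x : ℝ => |x| ^ γ * ‖f x‖ ^ 2 := by
  simpa [sq] using integrable_abs_rpow_mul hγ f f

lemma weightedSq_nonneg (γ : ℝ) (f : SchwartzMap ℝ ℂ) : 0 ≤ weightedSq γ f :=
  integral_nonneg fun x => by positivity

lemma weightedSq_smul (γ : ℝ) (z : ℂ) (f : SchwartzMap ℝ ℂ) :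
    weightedSq γ (z • f) = ‖z‖ ^ 2 * weightedSq γ f := by
  rw [weightedSq, weightedSq, ← integral_const_mul]
  congr 1
  ext x
  rw [smul_apply, norm_smul]
  ring

lemma weightedSq_schwartzRefl (γ : ℝ) (f : SchwartzMap ℝ ℂ) :
    weightedSq γ (schwartzRefl f) = weightedSq γ f := by
  rw [weightedSq, weightedSq, ← integral_neg_eq_self (fun x => |x| ^ γ * ‖f x‖ ^ 2) volume]
  simp [schwartzRefl_apply]

lemma weightedSq_add_le {γ : ℝ} (hγ : 0 ≤ γ) (f g : SchwartzMap ℝ ℂ) :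
    weightedSq γ (f + g) ≤ 2 * weightedSq γ f + 2 * weightedSq γ g := by
  have hf := (integrable_weightedSq hγ f).const_mul 2
  have hg := (integrable_weightedSq hγ g).const_mul 2
  rw [weightedSq, weightedSq, weightedSq, ← integral_const_mul, ← integral_const_mul,
    ← integral_add hf hg]
  refine integral_mono (integrable_weightedSq hγ _) (hf.add hg) fun x => ?_
  have h : ‖f x + g x‖ ^ 2 ≤ 2 * ‖f x‖ ^ 2 + 2 * ‖g x‖ ^ 2 := by
    have h1 := norm_add_le (f x) (g x)
    nlinarith [sq_nonneg (‖f x‖ - ‖g x‖), norm_nonneg (f x + g x)]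
  have h0 : 0 ≤ |x| ^ γ := by positivity
  simp only [add_apply]
  nlinarith

lemma hasDerivAt_mul_abs_rpow {γ : ℝ} (hγ : 0 ≤ γ) (x : ℝ) :
    HasDerivAt (fun y : ℝ => y * |y| ^ γ) ((γ + 1) * |x| ^ γ) x := by
  rcases eq_or_ne x 0 with rfl | hx
  · rw [hasDerivAt_iff_tendsto_slope]
    have h1 : Tendsto (fun y : ℝ => |y| ^ γ) (𝓝[≠] 0) (𝓝 (|0| ^ γ)) :=
      ((continuous_abs_rpow hγ).tendsto 0).mono_left nhdsWithin_le_nhds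
    have h2 : (γ + 1) * |(0 : ℝ)| ^ γ = |0| ^ γ := by
      rcases hγ.eq_or_lt with rfl | h
      · simp
      · simp [h.ne']
    rw [h2]
    refine h1.congr' (eventually_nhdsWithin_of_forall fun y hy => ?_)
    have hy' : y ≠ 0 := hy
    simp [slope_def_field, hy']
  · have h1 := (hasDerivAt_abs hx).rpow_const (p := γ) (Or.inl (abs_ne_zero.2 hx))
    refine ((hasDerivAt_id x).mul h1).congr_deriv ?_
    have h2 : x * (SignType.sign x : ℝ) = |x| := by rw [mul_comm, sign_mul_self]
    have h3 : |x| * |x| ^ (γ - 1) = |x| ^ γ := by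
      rw [mul_comm, Real.rpow_sub_one (abs_ne_zero.2 hx), div_mul_cancel₀ _ (abs_ne_zero.2 hx)]
    simp only [id_eq]
    linear_combination γ * |x| ^ (γ - 1) * h2 + γ * h3

/-- Hardy-type inequality: the Euler operator `x d/dx + c` is bounded below on `L²(|x|^γ dx)`
unless `c` is the critical exponent. -/
lemma weightedSq_le_euler {γ : ℝ} (hγ : 0 ≤ γ) {c : ℝ} (hc : c - (γ + 1) / 2 ≠ 0)
    (G : SchwartzMap ℝ ℂ) :
    weightedSq γ G ≤ (c - (γ + 1) / 2)⁻¹ ^ 2 *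
      weightedSq γ (schwartzX (schwartzD G) + (c : ℂ) • G) := by
  set δ := c - (γ + 1) / 2 with hδ
  set H := schwartzX (schwartzD G) + (c : ℂ) • G with hH
  have hinner : ∀ x, inner ℝ (G x) (H x) =
      x * inner ℝ (G x) (schwartzD G x) + c * ‖G x‖ ^ 2 := by
    intro x
    rw [hH, add_apply, smul_apply, schwartzX_apply, smul_eq_mul, ← Complex.real_smul,
      ← Complex.real_smul, inner_add_right, real_inner_smul_right, real_inner_smul_right,
      real_inner_self_eq_norm_sq]
  have hderiv : ∀ x : ℝ, HasDerivAt (fun y : ℝ => (y * |y| ^ γ) * ‖G y‖ ^ 2)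
      (2 * (|x| ^ γ * inner ℝ (G x) (H x)) - 2 * δ * (|x| ^ γ * ‖G x‖ ^ 2)) x := by
    intro x
    refine ((hasDerivAt_mul_abs_rpow hγ x).mul (schwartzD_hasDerivAt G x).norm_sq).congr_deriv ?_
    rw [hinner, hδ]
    ring
  have hGH := integrable_abs_rpow_mul hγ G H
  have hbound : ∀ x : ℝ, ‖|x| ^ γ * inner ℝ (G x) (H x)‖ ≤ |x| ^ γ * (‖G x‖ * ‖H x‖) := by
    intro x
    rw [norm_mul, Real.norm_of_nonneg (by positivity : 0 ≤ |x| ^ γ)]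
    gcongr
    exact norm_inner_le_norm _ _
  have hinnerInt : Integrable fun x : ℝ => |x| ^ γ * inner ℝ (G x) (H x) :=
    hGH.mono' (Continuous.aestronglyMeasurable
      ((continuous_abs_rpow hγ).mul (G.continuous.inner H.continuous))) (.of_forall hbound)
  have hGint := integrable_weightedSq hγ G
  have hHint := integrable_weightedSq hγ H
  have hprim : Integrable fun y : ℝ => (y * |y| ^ γ) * ‖G y‖ ^ 2 := by
    refine (integrable_abs_rpow_mul hγ (schwartzX G) G).mono'
      (Continuous.aestronglyMeasurable ?_) (.of_forall fun x => ?_)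
    · exact (continuous_id.mul (continuous_abs_rpow hγ)).mul (G.continuous.norm.pow 2)
    · rw [schwartzX_apply, norm_mul, norm_mul, norm_mul, Complex.norm_real,
        Real.norm_of_nonneg (by positivity : 0 ≤ |x| ^ γ), norm_pow, norm_norm]
      exact le_of_eq (by ring)
  have hzero := integral_eq_zero_of_hasDerivAt_of_integrable hderiv
    ((hinnerInt.const_mul 2).sub (hGint.const_mul (2 * δ))) hprim
  rw [integral_sub (hinnerInt.const_mul 2) (hGint.const_mul (2 * δ)), integral_const_mul,
    integral_const_mul] at hzero
  have hle : |δ| * weightedSq γ G ≤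
      |δ| / 2 * weightedSq γ G + (2 * |δ|)⁻¹ * weightedSq γ H := by
    calc |δ| * weightedSq γ G = ‖∫ x : ℝ, |x| ^ γ * inner ℝ (G x) (H x)‖ := by
          rw [show ∫ x : ℝ, |x| ^ γ * inner ℝ (G x) (H x) = δ * weightedSq γ G by
            rw [weightedSq]; linarith, norm_mul, Real.norm_of_nonneg (weightedSq_nonneg γ G),
            Real.norm_eq_abs]
      _ ≤ ∫ x : ℝ, (|δ| / 2 * (|x| ^ γ * ‖G x‖ ^ 2) +
            (2 * |δ|)⁻¹ * (|x| ^ γ * ‖H x‖ ^ 2)) := by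
          refine norm_integral_le_of_norm_le
            ((hGint.const_mul _).add (hHint.const_mul _)) (.of_forall fun x => ?_)
          refine (hbound x).trans ?_
          have hδ0 : 0 < |δ| := abs_pos.2 hc
          have h1 : ‖G x‖ * ‖H x‖ ≤ |δ| / 2 * ‖G x‖ ^ 2 + (2 * |δ|)⁻¹ * ‖H x‖ ^ 2 := by
            have h2 : |δ| / 2 * ‖G x‖ ^ 2 + (2 * |δ|)⁻¹ * ‖H x‖ ^ 2 - ‖G x‖ * ‖H x‖ =
                (2 * |δ|)⁻¹ * (|δ| * ‖G x‖ - ‖H x‖) ^ 2 := by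
              field_simp
              ring
            have h3 : 0 ≤ (2 * |δ|)⁻¹ * (|δ| * ‖G x‖ - ‖H x‖) ^ 2 := by positivity
            linarith
          calc |x| ^ γ * (‖G x‖ * ‖H x‖)
              ≤ |x| ^ γ * (|δ| / 2 * ‖G x‖ ^ 2 + (2 * |δ|)⁻¹ * ‖H x‖ ^ 2) := by gcongr
            _ = _ := by ring
      _ = _ := by
          rw [integral_add (hGint.const_mul _) (hHint.const_mul _), integral_const_mul,
            integral_const_mul]
          rfl
  have hδ0 : 0 < |δ| := abs_pos.2 hc
  have h4 : weightedSq γ G ≤ |δ|⁻¹ ^ 2 * weightedSq γ H := by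
    have h5 : |δ| / 2 * weightedSq γ G ≤ (2 * |δ|)⁻¹ * weightedSq γ H := by linarith
    calc weightedSq γ G = 2 * |δ|⁻¹ * (|δ| / 2 * weightedSq γ G) := by field_simp
      _ ≤ 2 * |δ|⁻¹ * ((2 * |δ|)⁻¹ * weightedSq γ H) := by gcongr
      _ = _ := by field_simp
  simpa [inv_pow, sq_abs] using h4

/-- One-dimensional Sobolev inequality. -/
lemma norm_sq_le_weightedSq_zero (v : SchwartzMap ℝ ℂ) (x : ℝ) :
    ‖v x‖ ^ 2 ≤ weightedSq 0 v + weightedSq 0 (schwartzD v) := by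
  have h1 := integrable_weightedSq le_rfl v
  have h2 := integrable_weightedSq le_rfl (schwartzD v)
  have hpt : ∀ y, ‖2 * inner ℝ (v y) (schwartzD v y)‖ ≤
      |y| ^ (0 : ℝ) * ‖v y‖ ^ 2 + |y| ^ (0 : ℝ) * ‖schwartzD v y‖ ^ 2 := by
    intro y
    have h3 := norm_inner_le_norm (𝕜 := ℝ) (v y) (schwartzD v y)
    rw [norm_mul, Real.norm_ofNat, Real.rpow_zero]
    nlinarith [sq_nonneg (‖v y‖ - ‖schwartzD v y‖)]
  have hint : Integrable fun y => 2 * inner ℝ (v y) (schwartzD v y) :=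
    (h1.add h2).mono' (Continuous.aestronglyMeasurable
      (continuous_const.mul (v.continuous.inner (schwartzD v).continuous))) (.of_forall hpt)
  have hsq : Integrable fun y => ‖v y‖ ^ 2 := by simpa using h1
  have hderiv : ∀ y, HasDerivAt (fun y => ‖v y‖ ^ 2) (2 * inner ℝ (v y) (schwartzD v y)) y :=
    fun y => (schwartzD_hasDerivAt v y).norm_sq
  have hlim := tendsto_zero_of_hasDerivAt_of_integrableOn_Iic (a := x) (fun y _ => hderiv y)
    hint.integrableOn hsq.integrableOn
  have heq := integral_Iic_of_hasDerivAt_of_tendsto' (a := x) (fun y _ => hderiv y)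
    hint.integrableOn hlim
  rw [sub_zero] at heq
  rw [← heq, weightedSq, weightedSq, ← integral_add h1 h2]
  have h12 : Integrable fun y : ℝ =>
      |y| ^ (0 : ℝ) * ‖v y‖ ^ 2 + |y| ^ (0 : ℝ) * ‖schwartzD v y‖ ^ 2 := h1.add h2
  calc ∫ y in Set.Iic x, 2 * inner ℝ (v y) (schwartzD v y)
      ≤ ∫ y in Set.Iic x, (|y| ^ (0 : ℝ) * ‖v y‖ ^ 2 + |y| ^ (0 : ℝ) * ‖schwartzD v y‖ ^ 2) :=
        integral_mono hint.integrableOn h12.integrableOn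
          fun y => (Real.le_norm_self _).trans (hpt y)
    _ ≤ _ := setIntegral_le_integral h12 (.of_forall fun y => by
        simp only [Pi.zero_apply]; positivity)

lemma iterate_clm_smul (L : SchwartzMap ℝ ℂ →L[ℂ] SchwartzMap ℝ ℂ) (n : ℕ) (z : ℂ)
    (v : SchwartzMap ℝ ℂ) : L^[n] (z • v) = z • L^[n] v := by
  induction n with
  | zero => rfl
  | succ n ih => rw [Function.iterate_succ_apply', ih, map_smul, Function.iterate_succ_apply']

lemma schwartzX_schwartzD_schwartzX_iterate (j : ℕ) (v : SchwartzMap ℝ ℂ) :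
    schwartzX (schwartzD (schwartzX^[j] v)) =
      schwartzX^[j + 1] (schwartzD v) + (j : ℂ) • schwartzX^[j] v := by
  induction j with
  | zero => simp
  | succ j ih =>
    rw [Function.iterate_succ_apply', schwartzD_schwartzX, map_add, ih,
      Function.iterate_succ_apply' _ (j + 1), map_add, map_smul]
    push_cast
    module

lemma schwartzD_iterate_schwartzX (n : ℕ) (v : SchwartzMap ℝ ℂ) :
    schwartzD^[n + 1] (schwartzX v) =
      schwartzX (schwartzD^[n + 1] v) + (n + 1 : ℂ) • schwartzD^[n] v := by
  induction n with
  | zero => simp [schwartzD_schwartzX]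
  | succ n ih =>
    rw [Function.iterate_succ_apply', ih, map_add, map_smul, schwartzD_schwartzX,
      ← Function.iterate_succ_apply' schwartzD (n + 1), ← Function.iterate_succ_apply' schwartzD n]
    push_cast
    module

/-- Powers of the derivative intertwine the Euler operators `x d/dx + c`. -/
lemma schwartzD_iterate_euler (n : ℕ) (c : ℂ) (v : SchwartzMap ℝ ℂ) :
    schwartzD^[n] (schwartzX (schwartzD v) + c • v) =
      schwartzX (schwartzD (schwartzD^[n] v)) + (c + n) • schwartzD^[n] v := by
  induction n with
  | zero => simp
  | succ n ih =>
    rw [Function.iterate_succ_apply', ih, map_add, map_smul, schwartzD_schwartzX,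
      Function.iterate_succ_apply']
    push_cast
    module

lemma schwartzD_iterate_schwartzRefl (n : ℕ) (v : SchwartzMap ℝ ℂ) :
    schwartzD^[n] (schwartzRefl v) = ((-1 : ℂ) ^ n) • schwartzRefl (schwartzD^[n] v) := by
  induction n with
  | zero => simp
  | succ n ih =>
    rw [Function.iterate_succ_apply', ih, map_smul, schwartzD_schwartzRefl,
      ← Function.iterate_succ_apply' schwartzD n]
    module

lemma weightedSq_zero_schwartzX_iterate_le (j : ℕ) (v : SchwartzMap ℝ ℂ) :
    weightedSq 0 (schwartzX^[j] v) ≤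
      (-j - 1 / 2 : ℝ)⁻¹ ^ 2 * weightedSq 0 (schwartzX^[j + 1] (schwartzD v)) := by
  have hc : (-j : ℝ) - (0 + 1) / 2 ≠ 0 := by
    have : (0 : ℝ) ≤ j := Nat.cast_nonneg j
    linarith
  have h := weightedSq_le_euler le_rfl hc (schwartzX^[j] v)
  rw [schwartzX_schwartzD_schwartzX_iterate, zero_add] at h
  convert h using 3
  push_cast
  module

lemma exists_weightedSq_zero_le (j : ℕ) :
    ∃ C, 0 ≤ C ∧ ∀ v, weightedSq 0 v ≤ C * weightedSq 0 (schwartzX^[j] (schwartzD^[j] v)) := by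
  induction j with
  | zero => exact ⟨1, zero_le_one, fun v => by simp⟩
  | succ j ih =>
    obtain ⟨C, hC, h⟩ := ih
    refine ⟨C * (-j - 1 / 2 : ℝ)⁻¹ ^ 2, by positivity, fun v => (h v).trans ?_⟩
    rw [mul_assoc, Function.iterate_succ_apply' schwartzD]
    gcongr
    exact weightedSq_zero_schwartzX_iterate_le j _

lemma schwartzX_iterate_apply (j : ℕ) (v : SchwartzMap ℝ ℂ) (x : ℝ) :
    schwartzX^[j] v x = (x : ℂ) ^ j * v x := by
  induction j with
  | zero => simp
  | succ j ih => rw [Function.iterate_succ_apply', schwartzX_apply, ih]; ring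

lemma weightedSq_zero_schwartzX_iterate_le_weightedSq {γ : ℝ} (hγ : 0 ≤ γ) {j : ℕ}
    (hj : γ ≤ j) (v : SchwartzMap ℝ ℂ) :
    weightedSq 0 (schwartzX^[j] v) ≤ weightedSq γ v + weightedSq γ (schwartzX^[j] v) := by
  have h1 := integrable_weightedSq hγ v
  have h2 := integrable_weightedSq hγ (schwartzX^[j] v)
  rw [weightedSq, weightedSq, weightedSq, ← integral_add h1 h2]
  refine integral_mono (integrable_weightedSq le_rfl _) (h1.add h2) fun x => ?_
  simp only [Real.rpow_zero, one_mul, schwartzX_iterate_apply, norm_mul, norm_pow,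
    Complex.norm_real, Real.norm_eq_abs, mul_pow]
  have h0 : 0 ≤ ‖v x‖ ^ 2 := by positivity
  suffices h : (|x| ^ j) ^ 2 ≤ |x| ^ γ + |x| ^ γ * (|x| ^ j) ^ 2 by nlinarith
  rcases le_total |x| 1 with hx | hx
  · have h3 : |x| ^ j ≤ |x| ^ γ := by
      rw [← Real.rpow_natCast]
      rcases (abs_nonneg x).eq_or_lt with h | h
      · rw [← h]
        rcases hγ.eq_or_lt with rfl | h'
        · exact (Real.rpow_le_one le_rfl zero_le_one (Nat.cast_nonneg j)).trans (by simp)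
        · rw [Real.zero_rpow h'.ne', Real.zero_rpow (h'.trans_le hj).ne']
      · exact Real.rpow_le_rpow_of_exponent_ge h hx hj
    have h4 : (|x| ^ j) ^ 2 ≤ |x| ^ j :=
      pow_le_of_le_one (by positivity) (pow_le_one₀ (abs_nonneg x) hx) two_ne_zero
    have h5 : 0 ≤ |x| ^ γ * (|x| ^ j) ^ 2 := by positivity
    linarith
  · have h3 : 1 ≤ |x| ^ γ := Real.one_le_rpow hx hγ
    have h5 : 0 ≤ (|x| ^ j) ^ 2 := by positivity
    nlinarith

/-- The Schwartz functions are bounded by finitely many weighted `L²` norms of derivatives. -/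
lemma exists_norm_sq_le_weightedSq {γ : ℝ} (hγ : 0 ≤ γ) {j : ℕ} (hj : γ ≤ j) :
    ∃ C, 0 ≤ C ∧ ∀ (v : SchwartzMap ℝ ℂ) (x : ℝ), ‖v x‖ ^ 2 ≤
      C * (weightedSq γ (schwartzD^[j] v) + weightedSq γ (schwartzX^[j] (schwartzD^[j] v)) +
        (weightedSq γ (schwartzD^[j + 1] v) +
          weightedSq γ (schwartzX^[j] (schwartzD^[j + 1] v)))) := by
  obtain ⟨C, hC, h⟩ := exists_weightedSq_zero_le j
  refine ⟨C, hC, fun v x => (norm_sq_le_weightedSq_zero v x).trans ?_⟩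
  rw [mul_add]
  gcongr
  · refine (h v).trans ?_
    gcongr
    exact weightedSq_zero_schwartzX_iterate_le_weightedSq hγ hj _
  · refine (h (schwartzD v)).trans ?_
    gcongr
    exact weightedSq_zero_schwartzX_iterate_le_weightedSq hγ hj _

lemma exists_weightedSq_schwartzD_succ_le {k : ℝ} (hk : -(1 / 2) ≤ k) (n : ℕ) :
    ∃ C, 0 ≤ C ∧ ∀ f, weightedSq (2 * k + 1) (schwartzD^[n + 1] f) ≤
      C * weightedSq (2 * k + 1) (schwartzD^[n] (schwartzDunkl k f)) := by
  have hγ : 0 ≤ 2 * k + 1 := by linarith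
  set δ : ℝ := (2 * k + 2 + n) - (2 * k + 1 + 1) / 2 with hδ
  have hδ0 : δ ≠ 0 := by
    have : (0 : ℝ) ≤ n := Nat.cast_nonneg n
    rw [hδ]
    linarith
  have hR : ∀ f, weightedSq (2 * k + 1) (schwartzD^[n] (schwartzR f)) ≤
      δ⁻¹ ^ 2 * weightedSq (2 * k + 1) (schwartzD^[n] (schwartzDunkl k f)) := by
    intro f
    have h1 := weightedSq_le_euler hγ hδ0 (schwartzD^[n] (schwartzR f))
    have h2 := schwartzD_iterate_euler n (2 * k + 2 : ℂ) (schwartzR f)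
    have h3 : ((2 * k + 2 + n : ℝ) : ℂ) = 2 * k + 2 + n := by push_cast; rfl
    rw [h3, ← h2, ← schwartzDunkl_add_schwartzRefl] at h1
    refine h1.trans ?_
    gcongr
    rw [iterate_clm_smul, iterate_map_add, schwartzD_iterate_schwartzRefl, weightedSq_smul]
    have h4 := weightedSq_add_le hγ (schwartzD^[n] (schwartzDunkl k f))
      ((-1 : ℂ) ^ n • schwartzRefl (schwartzD^[n] (schwartzDunkl k f)))
    rw [weightedSq_smul, weightedSq_schwartzRefl] at h4
    norm_num at h4 ⊢
    linarith
  refine ⟨2 + 2 * (‖(2 * k + 1 : ℂ)‖ ^ 2 * δ⁻¹ ^ 2), by positivity, fun f => ?_⟩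
  have h1 : schwartzD^[n + 1] f = schwartzD^[n] (schwartzDunkl k f) +
      (-(2 * k + 1 : ℂ)) • schwartzD^[n] (schwartzR f) := by
    rw [schwartzDunkl, iterate_map_add, iterate_clm_smul, Function.iterate_succ_apply]
    module
  rw [h1]
  refine (weightedSq_add_le hγ _ _).trans ?_
  rw [weightedSq_smul, norm_neg]
  have h2 := mul_le_mul_of_nonneg_left (hR f) (sq_nonneg ‖(2 * k + 1 : ℂ)‖)
  linarith

/-- In `L²(|x|^(2k+1) dx)`, ordinary derivatives are controlled by powers of the Dunkl operator. -/
lemma exists_weightedSq_schwartzD_iterate_le {k : ℝ} (hk : -(1 / 2) ≤ k) (n : ℕ) :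
    ∃ C, 0 ≤ C ∧ ∀ f, weightedSq (2 * k + 1) (schwartzD^[n] f) ≤
      C * weightedSq (2 * k + 1) ((schwartzDunkl k)^[n] f) := by
  induction n with
  | zero => exact ⟨1, zero_le_one, fun f => by simp⟩
  | succ n ih =>
    obtain ⟨C, hC, h⟩ := ih
    obtain ⟨C', hC', h'⟩ := exists_weightedSq_schwartzD_succ_le hk n
    refine ⟨C' * C, by positivity, fun f => (h' f).trans ?_⟩
    rw [mul_assoc, Function.iterate_succ_apply]
    gcongr
    exact h _

/-- Multiplication by `1 + x²` on the Schwartz space. -/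
noncomputable def schwartzJapanese (f : SchwartzMap ℝ ℂ) : SchwartzMap ℝ ℂ :=
  f + schwartzX (schwartzX f)

lemma schwartzJapanese_iterate_apply (m : ℕ) (f : SchwartzMap ℝ ℂ) (x : ℝ) :
    schwartzJapanese^[m] f x = (((1 + x ^ 2) ^ m : ℝ) : ℂ) * f x := by
  induction m with
  | zero => simp
  | succ m ih =>
    rw [Function.iterate_succ_apply', schwartzJapanese, add_apply, schwartzX_apply,
      schwartzX_apply, ih]
    push_cast
    ring

/-- The linear span of the operators `x^l T^n` and their reflections, where `T` is the linear
canonical Dunkl operator. -/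
inductive LcdSpan (k a b : ℝ) : (SchwartzMap ℝ ℂ → SchwartzMap ℝ ℂ) → Prop
  | monomial (l n : ℕ) : LcdSpan k a b fun φ => schwartzX^[l] ((schwartzLcd k a b)^[n] φ)
  | add {F G : SchwartzMap ℝ ℂ → SchwartzMap ℝ ℂ} (hF : LcdSpan k a b F) (hG : LcdSpan k a b G) :
      LcdSpan k a b fun φ => F φ + G φ
  | smul (z : ℂ) {F : SchwartzMap ℝ ℂ → SchwartzMap ℝ ℂ} (hF : LcdSpan k a b F) :
      LcdSpan k a b fun φ => z • F φ
  | refl {F : SchwartzMap ℝ ℂ → SchwartzMap ℝ ℂ} (hF : LcdSpan k a b F) :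
      LcdSpan k a b fun φ => schwartzRefl (F φ)

lemma LcdSpan.neg {k a b : ℝ} {F : SchwartzMap ℝ ℂ → SchwartzMap ℝ ℂ} (hF : LcdSpan k a b F) :
    LcdSpan k a b fun φ => -F φ := by
  simpa using hF.smul (-1)

lemma LcdSpan.schwartzX {k a b : ℝ} {F : SchwartzMap ℝ ℂ → SchwartzMap ℝ ℂ}
    (hF : LcdSpan k a b F) : LcdSpan k a b fun φ => schwartzX (F φ) := by
  induction hF with
  | monomial l n => simpa only [Function.iterate_succ_apply'] using monomial (k := k) (l + 1) n
  | add _ _ h1 h2 => simpa using h1.add h2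
  | smul z _ h => simpa using h.smul z
  | refl _ h => simpa only [schwartzX_schwartzRefl] using h.refl.neg

lemma LcdSpan.schwartzDunkl {k a b : ℝ} {F : SchwartzMap ℝ ℂ → SchwartzMap ℝ ℂ}
    (hF : LcdSpan k a b F) : LcdSpan k a b fun φ => schwartzDunkl k (F φ) := by
  induction hF with
  | monomial l n =>
    induction l with
    | zero =>
      have h1 := monomial (k := k) (a := a) (b := b) 0 (n + 1)
      have h2 := (monomial (k := k) (a := a) (b := b) 1 n).smul (-(Complex.I * ((a / b : ℝ) : ℂ)))
      convert h1.add h2 using 2 with φ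
      simp only [Function.iterate_succ_apply', Function.iterate_zero, id_eq, schwartzLcd]
      module
    | succ l ih =>
      have h := monomial (k := k) (a := a) (b := b) l n
      simp only [Function.iterate_succ_apply' _root_.schwartzX, schwartzDunkl_schwartzX]
      exact (ih.schwartzX.add h).add (h.refl.smul _)
  | add _ _ h1 h2 => simpa only [schwartzDunkl_add] using h1.add h2
  | smul z _ h => simpa only [schwartzDunkl_smul] using h.smul z
  | refl _ h => simpa only [schwartzDunkl_schwartzRefl] using h.refl.neg

lemma LcdSpan.schwartzDunkl_iterate {k a b : ℝ} {F : SchwartzMap ℝ ℂ → SchwartzMap ℝ ℂ}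
    (hF : LcdSpan k a b F) (n : ℕ) :
    LcdSpan k a b fun φ => (_root_.schwartzDunkl k)^[n] (F φ) := by
  induction n with
  | zero => exact hF
  | succ n ih => simpa only [Function.iterate_succ_apply'] using ih.schwartzDunkl

lemma lcdSpan_schwartzJapanese_iterate (k a b : ℝ) (q : ℕ) :
    LcdSpan k a b fun φ => schwartzJapanese^[q] φ := by
  induction q with
  | zero => exact LcdSpan.monomial 0 0
  | succ q ih =>
    simp only [Function.iterate_succ_apply', schwartzJapanese]
    exact ih.add ih.schwartzX.schwartzX

/-- The sum of the squared norms `‖(1 + x²)^m T^n φ‖²` over `m, n < M`. -/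
noncomputable def lcdSum (k a b : ℝ) (M : ℕ) (φ : SchwartzMap ℝ ℂ) : ℝ :=
  ∑ i ∈ Finset.range M ×ˢ Finset.range M,
    weightedSq (2 * k + 1) (schwartzJapanese^[i.1] ((schwartzLcd k a b)^[i.2] φ))

lemma lcdSum_mono (k a b : ℝ) {M N : ℕ} (h : M ≤ N) (φ : SchwartzMap ℝ ℂ) :
    lcdSum k a b M φ ≤ lcdSum k a b N φ :=
  Finset.sum_le_sum_of_subset_of_nonneg
    (Finset.product_subset_product (Finset.range_mono h) (Finset.range_mono h))
    fun _ _ _ => weightedSq_nonneg _ _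

/-- A functional is dominated if it is bounded by finitely many of the squared norms
`‖(1 + x²)^m T^n φ‖²`. -/
def LcdDominated (k a b : ℝ) (S : SchwartzMap ℝ ℂ → ℝ) : Prop :=
  ∃ C, 0 ≤ C ∧ ∃ M, ∀ φ, S φ ≤ C * lcdSum k a b M φ

lemma LcdDominated.mono {k a b : ℝ} {S S' : SchwartzMap ℝ ℂ → ℝ} (hS : LcdDominated k a b S)
    (h : ∀ φ, S' φ ≤ S φ) : LcdDominated k a b S' := by
  obtain ⟨C, hC, M, hM⟩ := hS
  exact ⟨C, hC, M, fun φ => (h φ).trans (hM φ)⟩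

lemma LcdDominated.const_mul {k a b : ℝ} {S : SchwartzMap ℝ ℂ → ℝ} (hS : LcdDominated k a b S)
    {c : ℝ} (hc : 0 ≤ c) : LcdDominated k a b fun φ => c * S φ := by
  obtain ⟨C, hC, M, hM⟩ := hS
  refine ⟨c * C, by positivity, M, fun φ => ?_⟩
  exact (mul_le_mul_of_nonneg_left (hM φ) hc).trans_eq (mul_assoc _ _ _).symm

lemma LcdDominated.add {k a b : ℝ} {S S' : SchwartzMap ℝ ℂ → ℝ} (hS : LcdDominated k a b S)
    (hS' : LcdDominated k a b S') : LcdDominated k a b fun φ => S φ + S' φ := by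
  obtain ⟨C, hC, M, hM⟩ := hS
  obtain ⟨C', hC', M', hM'⟩ := hS'
  refine ⟨C + C', by positivity, max M M', fun φ => ?_⟩
  rw [add_mul]
  refine add_le_add ?_ ?_
  · refine (hM φ).trans ?_
    gcongr
    exact lcdSum_mono _ _ _ (le_max_left _ _) _
  · refine (hM' φ).trans ?_
    gcongr
    exact lcdSum_mono _ _ _ (le_max_right _ _) _

lemma weightedSq_schwartzX_iterate_le {γ : ℝ} (hγ : 0 ≤ γ) (l : ℕ) (f : SchwartzMap ℝ ℂ) :
    weightedSq γ (schwartzX^[l] f) ≤ weightedSq γ (schwartzJapanese^[l] f) := by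
  refine integral_mono (integrable_weightedSq hγ _) (integrable_weightedSq hγ _) fun x => ?_
  simp only [schwartzX_iterate_apply, schwartzJapanese_iterate_apply, norm_mul, norm_pow,
    Complex.norm_real]
  gcongr
  rw [Real.norm_eq_abs, Real.norm_of_nonneg (by positivity)]
  nlinarith [sq_abs x, sq_nonneg (|x| - 1), abs_nonneg x]

lemma LcdSpan.lcdDominated {k a b : ℝ} (hk : -(1 / 2) ≤ k)
    {F : SchwartzMap ℝ ℂ → SchwartzMap ℝ ℂ} (hF : LcdSpan k a b F) :
    LcdDominated k a b fun φ => weightedSq (2 * k + 1) (F φ) := by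
  have hγ : 0 ≤ 2 * k + 1 := by linarith
  induction hF with
  | monomial l n =>
    refine ⟨1, zero_le_one, max l n + 1, fun φ => ?_⟩
    rw [one_mul]
    refine (weightedSq_schwartzX_iterate_le hγ l _).trans ?_
    refine Finset.single_le_sum (f := fun i : ℕ × ℕ =>
      weightedSq (2 * k + 1) (schwartzJapanese^[i.1] ((schwartzLcd k a b)^[i.2] φ)))
      (fun _ _ => weightedSq_nonneg _ _) (a := (l, n)) ?_
    simp only [Finset.mem_product, Finset.mem_range]
    omega
  | add _ _ h1 h2 =>
    exact ((h1.const_mul zero_le_two).add (h2.const_mul zero_le_two)).mono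
      fun φ => weightedSq_add_le hγ _ _
  | smul z _ h => simpa only [weightedSq_smul] using h.const_mul (sq_nonneg _)
  | refl _ h => simpa only [weightedSq_schwartzRefl] using h

lemma LcdSpan.lcdDominated_schwartzX_schwartzD {k a b : ℝ} (hk : -(1 / 2) ≤ k)
    {F : SchwartzMap ℝ ℂ → SchwartzMap ℝ ℂ} (hF : LcdSpan k a b F) (j n : ℕ) :
    LcdDominated k a b fun φ =>
      weightedSq (2 * k + 1) (_root_.schwartzX^[j] (schwartzD^[n] (F φ))) := by
  have hγ : 0 ≤ 2 * k + 1 := by linarith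
  induction j generalizing n F with
  | zero =>
    obtain ⟨C, hC, h⟩ := exists_weightedSq_schwartzD_iterate_le hk n
    exact (((hF.schwartzDunkl_iterate n).lcdDominated hk).const_mul hC).mono fun φ => h _
  | succ j ih =>
    cases n with
    | zero =>
      have h := ih hF.schwartzX 0
      simpa only [Function.iterate_succ_apply, Function.iterate_zero, id_eq] using h
    | succ n =>
      refine (((ih hF.schwartzX (n + 1)).const_mul zero_le_two).add
        (((ih hF n).const_mul (sq_nonneg ‖-(n + 1 : ℂ)‖)).const_mul zero_le_two)).mono
        fun φ => ?_
      rw [← weightedSq_smul]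
      convert weightedSq_add_le hγ _ _ using 2
      rw [schwartzD_iterate_schwartzX, iterate_map_add, iterate_clm_smul,
        Function.iterate_succ_apply]
      module

lemma exists_norm_sq_iteratedDeriv_le {k : ℝ} (hk : -(1 / 2) ≤ k) (a b : ℝ) (p q : ℕ) :
    ∃ C, 0 ≤ C ∧ ∃ M, ∀ (φ : SchwartzMap ℝ ℂ) (x : ℝ),
      ‖schwartzD^[p] (schwartzJapanese^[q] φ) x‖ ^ 2 ≤ C * lcdSum k a b M φ := by
  obtain ⟨j, hj⟩ := exists_nat_ge (2 * k + 1)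
  obtain ⟨C, hC, h⟩ := exists_norm_sq_le_weightedSq (by linarith : 0 ≤ 2 * k + 1) hj
  have hd := (lcdSpan_schwartzJapanese_iterate k a b q).lcdDominated_schwartzX_schwartzD hk
  obtain ⟨C', hC', M, hM⟩ := (((hd 0 (j + p)).add (hd j (j + p))).add
    ((hd 0 (j + 1 + p)).add (hd j (j + 1 + p)))).const_mul hC
  refine ⟨C', hC', M, fun φ x => (h _ x).trans ?_⟩
  simpa only [← Function.iterate_add_apply schwartzD, Function.iterate_zero, id_eq] using hM φ

lemma weightedSq_eq_eLpNorm {k : ℝ} (hk : -(1 / 2) ≤ k) (f : SchwartzMap ℝ ℂ) :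
    weightedSq (2 * k + 1) f =
      2 ^ (k + 1) * Real.Gamma (k + 1) * (eLpNorm f 2 (muK k)).toReal ^ 2 := by
  have hγ : 0 ≤ 2 * k + 1 := by linarith
  set c : ℝ := 2 ^ (k + 1) * Real.Gamma (k + 1) with hc
  have hc0 : 0 < c := mul_pos (by positivity) (Real.Gamma_pos_of_pos (by linarith))
  have hmeas : Measurable fun x : ℝ => ENNReal.ofReal (|x| ^ (2 * k + 1) / c) :=
    ((continuous_abs_rpow hγ).div_const c).measurable.ennreal_ofReal
  have h1 : eLpNorm f 2 (muK k) ^ 2 = ENNReal.ofReal (c⁻¹ * weightedSq (2 * k + 1) f) := by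
    have h2 := eLpNorm_nnreal_pow_eq_lintegral (f := f) (μ := muK k) (p := 2) two_ne_zero
    norm_num at h2
    rw [h2, muK, lintegral_withDensity_eq_lintegral_mul _ hmeas (by fun_prop), weightedSq,
      ← integral_const_mul, ofReal_integral_eq_lintegral_ofReal
        ((integrable_weightedSq hγ f).const_mul _) (.of_forall fun x => by positivity)]
    congr 1
    ext x
    rw [Pi.mul_apply, ← ofReal_norm, ← ENNReal.ofReal_pow (norm_nonneg _),
      ← ENNReal.ofReal_mul (by positivity)]
    congr 1
    ring
  rw [← ENNReal.toReal_pow, h1, ENNReal.toReal_ofReal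
    (mul_nonneg (by positivity) (weightedSq_nonneg _ _)), mul_inv_cancel_left₀ (ne_of_gt hc0)]

/-- Every standard Schwartz seminorm `φ ↦ sup_x |(d/dx)^p((1+x²)^q φ(x))|` is dominated by
finitely many of the seminorms `φ ↦ ‖(1+x²)^m Λ_{k,M⁻¹}ⁿ φ‖_{L²_k}`. -/
theorem stmt_8 (k a b c d : ℝ) (hk : -(1/2) ≤ k) (hM : a * d - b * c = 1) (hb : b ≠ 0)
    (p q : ℕ) :
    ∃ C > (0 : ℝ), ∃ N : ℕ, ∃ m n : Fin N → ℕ, ∀ φ : SchwartzMap ℝ ℂ,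
      (⨆ x : ℝ, ‖iteratedDeriv p (fun y : ℝ => (((1 + y ^ 2) ^ q : ℝ) : ℂ) * φ y) x‖) ≤
        C * ∑ i : Fin N,
          (eLpNorm (fun x : ℝ => (((1 + x ^ 2) ^ (m i) : ℝ) : ℂ) * (lcdOp k a b)^[n i] (⇑φ) x)
            2 (muK k)).toReal := by
  obtain ⟨C, hC, M, hM⟩ := exists_norm_sq_iteratedDeriv_le hk a b p q
  set s : Finset (ℕ × ℕ) := Finset.range M ×ˢ Finset.range M
  set K : ℝ := 2 ^ (k + 1) * Real.Gamma (k + 1)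
  have hK : 0 < K := mul_pos (by positivity) (Real.Gamma_pos_of_pos (by linarith))
  refine ⟨√(C * K) + 1, by positivity, s.card, fun i => (s.equivFin.symm i).1.1,
    fun i => (s.equivFin.symm i).1.2, fun φ => ?_⟩
  set N : ℕ × ℕ → ℝ := fun i => (eLpNorm
    (fun x : ℝ => (((1 + x ^ 2) ^ i.1 : ℝ) : ℂ) * (lcdOp k a b)^[i.2] (⇑φ) x)
      2 (muK k)).toReal
  have hN : ∀ i, 0 ≤ N i := fun i => ENNReal.toReal_nonneg
  have hsum : ∑ i : Fin s.card, N (s.equivFin.symm i).1 = ∑ i ∈ s, N i := by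
    rw [Equiv.sum_comp s.equivFin.symm fun i : s => N i.1, Finset.sum_coe_sort]
  have hlcd : lcdSum k a b M φ = K * ∑ i ∈ s, N i ^ 2 := by
    rw [lcdSum, Finset.mul_sum]
    refine Finset.sum_congr rfl fun i _ => ?_
    rw [weightedSq_eq_eLpNorm hk]
    congr! 4
    ext x
    rw [schwartzJapanese_iterate_apply, coe_schwartzLcd_iterate]
  change _ ≤ (√(C * K) + 1) * ∑ i : Fin s.card, N (s.equivFin.symm i).1
  rw [hsum]
  have hS : 0 ≤ ∑ i ∈ s, N i := Finset.sum_nonneg fun i _ => hN i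
  refine Real.iSup_le (fun x => ?_) (by positivity)
  have hfun : (fun y : ℝ => (((1 + y ^ 2) ^ q : ℝ) : ℂ) * φ y) = schwartzJapanese^[q] φ :=
    funext fun y => (schwartzJapanese_iterate_apply q φ y).symm
  rw [hfun, ← schwartzD_iterate_apply]
  have h1 : ‖schwartzD^[p] (schwartzJapanese^[q] φ) x‖ ^ 2 ≤ (√(C * K) * ∑ i ∈ s, N i) ^ 2 := by
    rw [mul_pow, Real.sq_sqrt (by positivity)]
    refine (hM φ x).trans ?_
    rw [hlcd, ← mul_assoc]
    gcongr
    exact Finset.sum_sq_le_sq_sum_of_nonneg fun i _ => hN i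
  have h2 := le_of_sq_le_sq h1 (by positivity)
  linarith
end

section
/- Let f : ℝ → ℂ be infinitely differentiable, let R > 0 and let n ∈ ℕ. There exist constants C > 0 and C_n > 0 such that for every x ∈ [-R, R] there exist points ξ₀, ξ₁, …, ξ_n ∈ [-R, R] (depending on x and n) with |Λ_{k,M⁻¹}ⁿ f(x)| ≤ C ( Σ_{j=0}^{n} C(n,j) |f^{(n-j)}(x)| + C_n Σ_{i=0}^{n} Σ_{j=0}^{n} |f^{(n-j)}(ξ_i)| ), where C(n,j) denotes the binomial coefficient. -/
open MeasureTheory Filter Complex Topology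
open scoped ENNReal

/-- The derivatives of `f` of order at most `m` are bounded by `S` on `[-R, R]`. -/
def DerivBound (R : ℝ) (m : ℕ) (f : ℝ → ℂ) (S : ℝ) : Prop :=
  ∀ j ≤ m, ∀ x ∈ Set.Icc (-R) R, ‖iteratedDeriv j f x‖ ≤ S

/-- The weighted dilation average `x ↦ ∫_{-1}^1 t^m h(tx) dt`. -/
noncomputable def dilationMean (m : ℕ) (h : ℝ → ℂ) (x : ℝ) : ℂ :=
  ∫ t in (-1 : ℝ)..1, (t : ℂ) ^ m * h (t * x)

lemma hasDerivAt_dilationMean {h : ℝ → ℂ} (hh : ContDiff ℝ (⊤ : ℕ∞) h) (m : ℕ) (x : ℝ) :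
    HasDerivAt (dilationMean m h) (dilationMean (m + 1) (deriv h) x) x := by
  have hd : ContDiff ℝ (⊤ : ℕ∞) (deriv h) := (contDiff_infty_iff_deriv.mp hh).2
  have hc := hh.continuous
  have hdc := hd.continuous
  obtain ⟨B, hB⟩ := (isCompact_Icc (a := -(|x| + 1)) (b := |x| + 1)).exists_bound_of_continuousOn
    hdc.continuousOn
  refine (intervalIntegral.hasDerivAt_integral_of_dominated_loc_of_deriv_le
    (F := fun y t => (t : ℂ) ^ m * h (t * y))
    (F' := fun y t => (t : ℂ) ^ (m + 1) * deriv h (t * y)) (bound := fun _ => B)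
    (Metric.ball_mem_nhds x one_pos) (Eventually.of_forall fun y => ?_) ?_ ?_ ?_ ?_ ?_).2
  · exact Continuous.aestronglyMeasurable (by fun_prop)
  · exact Continuous.intervalIntegrable (by fun_prop) _ _
  · exact Continuous.aestronglyMeasurable (by fun_prop)
  · refine Eventually.of_forall fun t ht y hy => ?_
    rw [Set.uIoc_of_le (by norm_num)] at ht
    have ht1 : |t| ≤ 1 := abs_le.mpr ⟨ht.1.le, ht.2⟩
    have hy1 : |y| ≤ |x| + 1 := by
      rw [Metric.mem_ball, Real.dist_eq] at hy
      linarith [abs_sub_abs_le_abs_sub y x]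
    have hty : t * y ∈ Set.Icc (-(|x| + 1)) (|x| + 1) := by
      rw [Set.mem_Icc, ← abs_le, abs_mul]
      nlinarith [abs_nonneg t, abs_nonneg y]
    have hpow : ‖(t : ℂ) ^ (m + 1)‖ ≤ 1 := by
      rw [norm_pow, Complex.norm_real]
      exact pow_le_one₀ (norm_nonneg _) ht1
    rw [norm_mul]
    calc _ ≤ 1 * B := mul_le_mul hpow (hB _ hty) (norm_nonneg _) zero_le_one
      _ = B := one_mul B
  · exact intervalIntegrable_const
  · refine Eventually.of_forall fun t _ y _ => ?_
    have h1 : HasDerivAt h (deriv h (t * y)) (t * y) :=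
      (hh.differentiable (by simp)).differentiableAt.hasDerivAt
    have h2 : HasDerivAt (fun y : ℝ => t * y) t y := by
      simpa using (hasDerivAt_id y).const_mul t
    have h3 := (h1.scomp y h2).const_mul ((t : ℂ) ^ m)
    refine h3.congr_deriv ?_
    rw [Complex.real_smul]
    ring

lemma deriv_dilationMean {h : ℝ → ℂ} (hh : ContDiff ℝ (⊤ : ℕ∞) h) (m : ℕ) :
    deriv (dilationMean m h) = dilationMean (m + 1) (deriv h) :=
  funext fun x => (hasDerivAt_dilationMean hh m x).deriv

lemma iteratedDeriv_dilationMean (j : ℕ) : ∀ {h : ℝ → ℂ}, ContDiff ℝ (⊤ : ℕ∞) h → ∀ m,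
    iteratedDeriv j (dilationMean m h) = dilationMean (m + j) (iteratedDeriv j h) := by
  induction j with
  | zero => simp
  | succ j ih =>
    intro h hh m
    rw [iteratedDeriv_succ', deriv_dilationMean hh, ih (contDiff_infty_iff_deriv.mp hh).2,
      ← iteratedDeriv_succ', add_assoc, add_comm 1 j]

lemma ContDiff.iteratedDeriv_infty {h : ℝ → ℂ} (hh : ContDiff ℝ (⊤ : ℕ∞) h) (j : ℕ) :
    ContDiff ℝ (⊤ : ℕ∞) (iteratedDeriv j h) := by
  rw [iteratedDeriv_eq_iterate]
  exact ContDiff.iterate_deriv j hh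

lemma contDiff_dilationMean {h : ℝ → ℂ} (hh : ContDiff ℝ (⊤ : ℕ∞) h) (m : ℕ) :
    ContDiff ℝ (⊤ : ℕ∞) (dilationMean m h) := by
  refine contDiff_of_differentiable_iteratedDeriv fun j _ => ?_
  rw [iteratedDeriv_dilationMean j hh]
  exact fun x => (hasDerivAt_dilationMean (hh.iteratedDeriv_infty j) _ x).differentiableAt

lemma DerivBound.dilationMean {R S : ℝ} {m : ℕ} {h : ℝ → ℂ} (hh : ContDiff ℝ (⊤ : ℕ∞) h)
    (hS : DerivBound R m h S) : DerivBound R m (dilationMean 0 h) (2 * S) := by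
  intro j hj x hx
  rw [iteratedDeriv_dilationMean j hh]
  refine (intervalIntegral.norm_integral_le_of_norm_le_const (C := S) fun t ht => ?_).trans
    (by norm_num [mul_comm])
  rw [Set.uIoc_of_le (by norm_num)] at ht
  have ht1 : |t| ≤ 1 := abs_le.mpr ⟨ht.1.le, ht.2⟩
  have htx : t * x ∈ Set.Icc (-R) R := by
    rw [Set.mem_Icc, ← abs_le] at hx ⊢
    rw [abs_mul]
    nlinarith [abs_nonneg t, abs_nonneg x]
  have hpow : ‖(t : ℂ) ^ (0 + j)‖ ≤ 1 := by
    rw [norm_pow, Complex.norm_real]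
    exact pow_le_one₀ (norm_nonneg _) ht1
  rw [norm_mul]
  calc _ ≤ 1 * S := mul_le_mul hpow (hS j hj _ htx) (norm_nonneg _) zero_le_one
    _ = S := one_mul S

lemma mul_dilationMean_deriv {f : ℝ → ℂ} (hf : ContDiff ℝ (⊤ : ℕ∞) f) (x : ℝ) :
    (x : ℂ) * dilationMean 0 (deriv f) x = f x - f (-x) := by
  have hc := (contDiff_infty_iff_deriv.mp hf).2.continuous
  have key := intervalIntegral.integral_eq_sub_of_hasDerivAt (a := -1) (b := 1)
    (f := fun t : ℝ => f (t * x)) (f' := fun t : ℝ => (x : ℂ) * deriv f (t * x))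
    (fun t _ => by
      have h1 : HasDerivAt f (deriv f (t * x)) (t * x) :=
        (hf.differentiable (by simp)).differentiableAt.hasDerivAt
      have h2 : HasDerivAt (fun t : ℝ => t * x) x t := by
        simpa using (hasDerivAt_id t).mul_const x
      exact (h1.scomp t h2).congr_deriv (Complex.real_smul))
    (Continuous.intervalIntegrable (by fun_prop) _ _)
  rw [intervalIntegral.integral_const_mul] at key
  simpa [dilationMean] using key

lemma lcdOp_eq {f : ℝ → ℂ} (hf : ContDiff ℝ (⊤ : ℕ∞) f) (k a b : ℝ) :
    lcdOp k a b f = fun x => (deriv f x + ((2 * k + 1) / 2 : ℂ) * dilationMean 0 (deriv f) x) +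
      (Complex.I * ((a / b : ℝ) : ℂ)) * ((x : ℂ) * f x) := by
  funext x
  rw [lcdOp, dunklOp, ← mul_assoc]
  congr 1
  split_ifs with hx
  · subst hx
    have h0 : dilationMean 0 (deriv f) 0 = 2 * deriv f 0 := by
      simp only [dilationMean, mul_zero, pow_zero, one_mul, intervalIntegral.integral_const]
      rw [Complex.real_smul]
      norm_num
    rw [h0]
    ring
  · have hx' : (x : ℂ) ≠ 0 := Complex.ofReal_ne_zero.mpr hx
    rw [← mul_dilationMean_deriv hf x]
    push_cast
    field_simp

lemma iteratedDeriv_ofReal_mul {f : ℝ → ℂ} (hf : ContDiff ℝ (⊤ : ℕ∞) f) (j : ℕ) :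
    iteratedDeriv j (fun x : ℝ => (x : ℂ) * f x) =
      fun x : ℝ => (x : ℂ) * iteratedDeriv j f x + j * iteratedDeriv (j - 1) f x := by
  induction j with
  | zero => simp
  | succ j ih =>
    funext x
    rw [iteratedDeriv_succ, ih]
    have hd (i : ℕ) : HasDerivAt (iteratedDeriv i f) (iteratedDeriv (i + 1) f x) x := by
      rw [iteratedDeriv_succ]
      exact ((hf.iteratedDeriv_infty i).differentiable (by simp)).differentiableAt.hasDerivAt
    have h1 := (Complex.ofRealCLM.hasDerivAt (x := x)).mul (hd j)
    have h2 := (hd (j - 1)).const_mul (j : ℂ)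
    refine ((h1.add h2).congr_deriv ?_).deriv
    rcases j with _ | j
    · simp
      ring
    · simp
      ring

lemma contDiff_lcdOp {f : ℝ → ℂ} (hf : ContDiff ℝ (⊤ : ℕ∞) f) (k a b : ℝ) :
    ContDiff ℝ (⊤ : ℕ∞) (lcdOp k a b f) := by
  have hd := (contDiff_infty_iff_deriv.mp hf).2
  rw [lcdOp_eq hf]
  exact (hd.add (contDiff_const.mul (contDiff_dilationMean hd 0))).add
    (contDiff_const.mul (Complex.ofRealCLM.contDiff.mul hf))

lemma exists_derivBound_lcdOp (k a b : ℝ) {R : ℝ} (hR : 0 < R) (m : ℕ) :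
    ∃ K > (0 : ℝ), ∀ f : ℝ → ℂ, ContDiff ℝ (⊤ : ℕ∞) f → ∀ S, DerivBound R (m + 1) f S →
      DerivBound R m (lcdOp k a b f) (K * S) := by
  refine ⟨1 + ‖((2 * k + 1) / 2 : ℂ)‖ * 2 + ‖Complex.I * ((a / b : ℝ) : ℂ)‖ * (R + m),
    by positivity, fun f hf S hS j hj x hx => ?_⟩
  have hd := (contDiff_infty_iff_deriv.mp hf).2
  have hdS : DerivBound R m (deriv f) S := fun i hi y hy => by
    rw [← iteratedDeriv_succ']
    exact hS (i + 1) (by omega) y hy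
  have hS0 : 0 ≤ S := (norm_nonneg _).trans (hS 0 (by omega) x hx)
  have hxf : ContDiff ℝ (⊤ : ℕ∞) (fun x : ℝ => (x : ℂ) * f x) :=
    Complex.ofRealCLM.contDiff.mul hf
  have le_top : ((j : ℕ∞) : WithTop ℕ∞) ≤ ((⊤ : ℕ∞) : WithTop ℕ∞) := by exact_mod_cast le_top
  have hmean := contDiff_dilationMean hd 0
  have e1 := (hd.of_le le_top).contDiffAt (x := x)
  have e2 := ((contDiff_const (c := ((2 * k + 1) / 2 : ℂ))).mul hmean |>.of_le le_top).contDiffAt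
    (x := x)
  have e3 := ((contDiff_const (c := Complex.I * ((a / b : ℝ) : ℂ))).mul hxf
    |>.of_le le_top).contDiffAt (x := x)
  rw [lcdOp_eq hf, iteratedDeriv_fun_add (e1.add e2) e3, iteratedDeriv_fun_add e1 e2,
    iteratedDeriv_const_mul_field, iteratedDeriv_const_mul_field, iteratedDeriv_ofReal_mul hf]
  have b1 := hdS j hj x hx
  have b2 := hdS.dilationMean hd j hj x hx
  have b3 : ‖(x : ℂ) * iteratedDeriv j f x + j * iteratedDeriv (j - 1) f x‖ ≤ (R + m) * S := by
    refine (norm_add_le _ _).trans ?_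
    rw [norm_mul, norm_mul, Complex.norm_real, Complex.norm_natCast, Real.norm_eq_abs, add_mul]
    have hjm : (j : ℝ) ≤ m := by exact_mod_cast hj
    exact add_le_add
      (mul_le_mul (abs_le.mpr hx) (hS j (by omega) x hx) (norm_nonneg _) hR.le)
      (mul_le_mul hjm (hS (j - 1) (by omega) x hx) (norm_nonneg _) (Nat.cast_nonneg m))
  calc _ ≤ _ := (norm_add_le _ _).trans (add_le_add_left (norm_add_le _ _) _)
    _ ≤ S + ‖((2 * k + 1) / 2 : ℂ)‖ * (2 * S) +
        ‖Complex.I * ((a / b : ℝ) : ℂ)‖ * ((R + m) * S) := by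
      rw [norm_mul ((2 * k + 1) / 2 : ℂ), norm_mul (Complex.I * ((a / b : ℝ) : ℂ))]
      gcongr
    _ = _ := by ring

lemma exists_derivBound_iterate_lcdOp (k a b : ℝ) {R : ℝ} (hR : 0 < R) (n m : ℕ) :
    ∃ K > (0 : ℝ), ∀ f : ℝ → ℂ, ContDiff ℝ (⊤ : ℕ∞) f → ∀ S, DerivBound R (m + n) f S →
      DerivBound R m ((lcdOp k a b)^[n] f) (K * S) := by
  induction n with
  | zero => exact ⟨1, one_pos, fun f _ S hS => by simpa using hS⟩
  | succ n ih =>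
    obtain ⟨K, hK, hKf⟩ := ih
    obtain ⟨L, hL, hLf⟩ := exists_derivBound_lcdOp k a b hR (m + n)
    refine ⟨K * L, by positivity, fun f hf S hS => ?_⟩
    rw [Function.iterate_succ_apply, mul_assoc]
    exact hKf _ (contDiff_lcdOp hf k a b) _ (hLf f hf S hS)

/-- Pointwise estimate for iterates of the linear canonical Dunkl operator on `[-R, R]`. -/
theorem stmt_9 (k a b c d : ℝ) (hk : -(1/2) ≤ k) (hM : a * d - b * c = 1) (hb : b ≠ 0)
    (f : ℝ → ℂ) (hf : ContDiff ℝ (⊤ : ℕ∞) f) (R : ℝ) (hR : 0 < R) (n : ℕ) :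
    ∃ C > (0 : ℝ), ∃ Cn > (0 : ℝ), ∀ x ∈ Set.Icc (-R) R, ∃ ξ : Fin (n + 1) → ℝ,
      (∀ i, ξ i ∈ Set.Icc (-R) R) ∧
      ‖(lcdOp k a b)^[n] f x‖ ≤
        C * (∑ j ∈ Finset.range (n + 1), (n.choose j : ℝ) * ‖iteratedDeriv (n - j) f x‖ +
          Cn * ∑ i : Fin (n + 1), ∑ j ∈ Finset.range (n + 1), ‖iteratedDeriv (n - j) f (ξ i)‖) := by
  obtain ⟨K, hK, hKf⟩ := exists_derivBound_iterate_lcdOp k a b hR n 0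
  have hcont : Continuous fun y => ∑ j ∈ Finset.range (n + 1), ‖iteratedDeriv (n - j) f y‖ :=
    continuous_finsetSum _ fun j _ => (hf.iteratedDeriv_infty (n - j)).continuous.norm
  obtain ⟨y, hy, hmax⟩ := (isCompact_Icc (a := -R) (b := R)).exists_isMaxOn
    ⟨0, by constructor <;> linarith⟩ hcont.continuousOn
  set S := ∑ j ∈ Finset.range (n + 1), ‖iteratedDeriv (n - j) f y‖ with hSdef
  have hS0 : 0 ≤ S := Finset.sum_nonneg fun _ _ => norm_nonneg _
  have hS : DerivBound R (0 + n) f S := fun j hj x hx => by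
    have h1 := Finset.single_le_sum (f := fun j => ‖iteratedDeriv (n - j) f x‖)
      (fun _ _ => norm_nonneg _) (Finset.mem_range.mpr (show n - j < n + 1 by omega))
    rw [show n - (n - j) = j by omega] at h1
    exact h1.trans (hmax hx)
  refine ⟨K, hK, 1, one_pos, fun x hx => ⟨fun _ => y, fun _ => hy, ?_⟩⟩
  have h0 := hKf f hf S hS 0 le_rfl x hx
  rw [iteratedDeriv_zero] at h0
  refine h0.trans (mul_le_mul_of_nonneg_left ?_ hK.le)
  beta_reduce
  rw [← hSdef, Finset.sum_const, Finset.card_univ, Fintype.card_fin, nsmul_eq_mul, one_mul]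
  have hA : 0 ≤ ∑ j ∈ Finset.range (n + 1), (n.choose j : ℝ) * ‖iteratedDeriv (n - j) f x‖ :=
    Finset.sum_nonneg fun _ _ => by positivity
  push_cast
  nlinarith [mul_nonneg (Nat.cast_nonneg (α := ℝ) n) hS0]
end

section
/- Let f : ℝ → ℂ be infinitely differentiable, let R > 0 and let n ∈ ℕ. There exist a constant C > 0, a constant C_n⁰ > 0, and polynomials P₀, P₁, …, P_n with deg P_j ≤ j, such that for every x ∈ ℝ with |x| > R: |Λ_{k,M⁻¹}ⁿ f(x)| ≤ C ( Σ_{j=0}^{n} C(n,j) |P_j(x)| |f^{(n-j)}(x)| + C_n⁰ Σ_{i=0}^{n-1} Σ_{j=0}^{i} C(i,j) |P_j(x)| |f^{(i-j)}(x)| + C_n⁰ Σ_{i=0}^{n-1} Σ_{j=0}^{i} C(i,j) |P_j(-x)| |f^{(i-j)}(-x)| ), where C(n,j) denotes the binomial coefficient. -/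
open MeasureTheory Filter Complex Topology
open scoped ENNReal

/-- Functions that agree off the origin with a finite sum of terms `c x^p f^(m)(x)`, where `m ≤ n`
and `p + m ≤ n`, and `c x^p f^(m)(-x)`, where `m < n` and `p + m < n`. -/
inductive LaurentJet (f : ℝ → ℂ) (n : ℕ) : (ℝ → ℂ) → Prop
  | direct (c : ℂ) (p : ℤ) (m : ℕ) (hm : m ≤ n) (hp : p + m ≤ n) :
      LaurentJet f n (fun x => c * (x : ℂ) ^ p * iteratedDeriv m f x)
  | reflected (c : ℂ) (p : ℤ) (m : ℕ) (hm : m < n) (hp : p + m < n) :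
      LaurentJet f n (fun x => c * (x : ℂ) ^ p * iteratedDeriv m f (-x))
  | add {g h : ℝ → ℂ} (hg : LaurentJet f n g) (hh : LaurentJet f n h) :
      LaurentJet f n (fun x => g x + h x)
  | congr {g h : ℝ → ℂ} (hg : LaurentJet f n g) (hgh : ∀ x ≠ 0, h x = g x) : LaurentJet f n h

theorem hasDerivAt_ofReal_zpow (p : ℤ) {x : ℝ} (hx : x ≠ 0) :
    HasDerivAt (fun y : ℝ => (y : ℂ) ^ p) (p * (x : ℂ) ^ (p - 1)) x :=
  (hasDerivAt_zpow p (x : ℂ) (Or.inl (ofReal_ne_zero.mpr hx))).comp_ofReal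

theorem ContDiff.hasDerivAt_iteratedDeriv {f : ℝ → ℂ} (hf : ContDiff ℝ (⊤ : ℕ∞) f) (m : ℕ)
    (x : ℝ) : HasDerivAt (iteratedDeriv m f) (iteratedDeriv (m + 1) f x) x := by
  rw [iteratedDeriv_succ]
  exact (hf.differentiable_iteratedDeriv m (mod_cast WithTop.coe_lt_top _) x).hasDerivAt

namespace LaurentJet

variable {f g : ℝ → ℂ} {n : ℕ}

theorem const_mul (hg : LaurentJet f n g) (c : ℂ) : LaurentJet f n (fun x => c * g x) := by
  induction hg with
  | direct c' p m hm hp => exact (direct (c * c') p m hm hp).congr fun x _ => by ring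
  | reflected c' p m hm hp => exact (reflected (c * c') p m hm hp).congr fun x _ => by ring
  | add _ _ ihg ihh => exact (ihg.add ihh).congr fun x _ => by ring
  | congr _ hgh ih => exact ih.congr fun x hx => by rw [hgh x hx]

theorem zpow_mul (hg : LaurentJet f n g) {q : ℤ} (hq : q ≤ 1) :
    LaurentJet f (n + 1) (fun x => (x : ℂ) ^ q * g x) := by
  induction hg with
  | direct c p m hm hp =>
    refine (direct c (q + p) m (by omega) (by push_cast; omega)).congr fun x hx => ?_
    rw [zpow_add₀ (ofReal_ne_zero.mpr hx)]; ring
  | reflected c p m hm hp =>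
    refine (reflected c (q + p) m (by omega) (by push_cast; omega)).congr fun x hx => ?_
    rw [zpow_add₀ (ofReal_ne_zero.mpr hx)]; ring
  | add _ _ ihg ihh => exact (ihg.add ihh).congr fun x _ => by ring
  | congr _ hgh ih => exact ih.congr fun x hx => by rw [hgh x hx]

theorem inv_mul_comp_neg (hg : LaurentJet f n g) :
    LaurentJet f (n + 1) (fun x => (x : ℂ)⁻¹ * g (-x)) := by
  have key (c : ℂ) (p : ℤ) (w : ℂ) (x : ℝ) (hx : x ≠ 0) :
      (x : ℂ)⁻¹ * (c * ((-x : ℝ) : ℂ) ^ p * w) = c * (-1) ^ p * (x : ℂ) ^ (p - 1) * w := by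
    rw [ofReal_neg, neg_eq_neg_one_mul, mul_zpow, zpow_sub_one₀ (ofReal_ne_zero.mpr hx)]
    ring
  induction hg with
  | direct c p m hm hp =>
    exact (reflected (c * (-1) ^ p) (p - 1) m (by omega) (by push_cast; omega)).congr
      fun x hx => key _ _ _ x hx
  | reflected c p m hm hp =>
    refine (direct (c * (-1) ^ p) (p - 1) m (by omega) (by push_cast; omega)).congr fun x hx => ?_
    rw [key _ _ _ x hx, neg_neg]
  | add _ _ ihg ihh => exact (ihg.add ihh).congr fun x _ => by ring
  | congr _ hgh ih => exact ih.congr fun x hx => by rw [hgh (-x) (neg_ne_zero.mpr hx)]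

theorem exists_hasDerivAt (hf : ContDiff ℝ (⊤ : ℕ∞) f) (hg : LaurentJet f n g) :
    ∃ g', LaurentJet f (n + 1) g' ∧ ∀ x ≠ 0, HasDerivAt g (g' x) x := by
  induction hg with
  | direct c p m hm hp =>
    refine ⟨_, (direct (c * p) (p - 1) m (by omega) (by push_cast; omega)).add
      (direct c p (m + 1) (by omega) (by push_cast; omega)), fun x hx => ?_⟩
    exact (((hasDerivAt_ofReal_zpow p hx).const_mul c).mul
      (hf.hasDerivAt_iteratedDeriv m x)).congr_deriv (by ring)
  | reflected c p m hm hp =>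
    refine ⟨_, (reflected (c * p) (p - 1) m (by omega) (by push_cast; omega)).add
      (reflected (-c) p (m + 1) (by omega) (by push_cast; omega)), fun x hx => ?_⟩
    exact (((hasDerivAt_ofReal_zpow p hx).const_mul c).mul
      ((hf.hasDerivAt_iteratedDeriv m (-x)).scomp x (hasDerivAt_neg x))).congr_deriv
      (by simp only [Function.comp_apply, neg_smul, one_smul]; ring)
  | add _ _ ihg ihh =>
    obtain ⟨g', hg', hdg⟩ := ihg
    obtain ⟨h', hh', hdh⟩ := ihh
    exact ⟨_, hg'.add hh', fun x hx => (hdg x hx).add (hdh x hx)⟩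
  | congr _ hgh ih =>
    obtain ⟨g', hg', hdg⟩ := ih
    refine ⟨g', hg', fun x hx => (hdg x hx).congr_of_eventuallyEq ?_⟩
    filter_upwards [isOpen_ne.mem_nhds hx] with y hy using hgh y hy

theorem lcdOp (hf : ContDiff ℝ (⊤ : ℕ∞) f) (hg : LaurentJet f n g) (k a b : ℝ) :
    LaurentJet f (n + 1) (lcdOp k a b g) := by
  obtain ⟨g', hg', hdg⟩ := hg.exists_hasDerivAt hf
  refine (((hg'.add ((hg.zpow_mul (q := -1) (by norm_num)).const_mul ((2 * k + 1) / 2))).add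
    (hg.inv_mul_comp_neg.const_mul (-((2 * k + 1) / 2)))).add
    ((hg.zpow_mul (q := 1) le_rfl).const_mul (I * ((a / b : ℝ) : ℂ)))).congr fun x hx => ?_
  simp only [_root_.lcdOp, dunklOp, if_neg hx, (hdg x hx).deriv, zpow_neg_one, zpow_one]
  push_cast
  ring

theorem lcdOp_iterate (hf : ContDiff ℝ (⊤ : ℕ∞) f) (k a b : ℝ) (n : ℕ) :
    LaurentJet f n ((_root_.lcdOp k a b)^[n] f) := by
  induction n with
  | zero => exact (direct 1 0 0 le_rfl (by simp)).congr fun x _ => by simp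
  | succ n ih =>
    rw [Function.iterate_succ_apply']
    exact ih.lcdOp hf k a b

/-- If `B` dominates the top-weight terms, then it dominates every `LaurentJet` for `R < |x|`. -/
theorem exists_norm_le (hg : LaurentJet f n g) {R : ℝ} (hR : 0 < R) {B : ℝ → ℝ}
    (hdirect : ∀ x, ∀ m ≤ n, |x| ^ (n - m) * ‖iteratedDeriv m f x‖ ≤ B x)
    (hreflected : ∀ x, ∀ m < n, |x| ^ (n - 1 - m) * ‖iteratedDeriv m f (-x)‖ ≤ B x) :
    ∃ C > (0 : ℝ), ∀ x, R < |x| → ‖g x‖ ≤ C * B x := by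
  have key (c : ℂ) (p : ℤ) (q : ℕ) (hpq : p ≤ q) : ∃ C > (0 : ℝ), ∀ x : ℝ, R < |x| →
      ‖c * (x : ℂ) ^ p‖ ≤ C * |x| ^ q := by
    obtain ⟨d, hd⟩ := Int.le.dest hpq
    refine ⟨(‖c‖ + 1) / R ^ d, by positivity, fun x hx => ?_⟩
    have hx0 : 0 < |x| := hR.trans hx
    have hpow : |x| ^ q = |x| ^ p * |x| ^ d := by
      rw [← zpow_natCast, ← zpow_natCast, ← zpow_add₀ hx0.ne', hd]
    rw [norm_mul, norm_zpow, norm_real, Real.norm_eq_abs, hpow, div_mul_eq_mul_div,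
      le_div_iff₀ (by positivity), ← mul_assoc]
    gcongr
    linarith
  induction hg with
  | direct c p m hm hp =>
    obtain ⟨C, hC, h⟩ := key c p (n - m) (by omega)
    refine ⟨C, hC, fun x hx => ?_⟩
    rw [norm_mul]
    calc _ ≤ C * |x| ^ (n - m) * ‖iteratedDeriv m f x‖ := by gcongr; exact h x hx
      _ ≤ _ := by rw [mul_assoc]; gcongr; exact hdirect x m hm
  | reflected c p m hm hp =>
    obtain ⟨C, hC, h⟩ := key c p (n - 1 - m) (by omega)
    refine ⟨C, hC, fun x hx => ?_⟩
    rw [norm_mul]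
    calc _ ≤ C * |x| ^ (n - 1 - m) * ‖iteratedDeriv m f (-x)‖ := by gcongr; exact h x hx
      _ ≤ _ := by rw [mul_assoc]; gcongr; exact hreflected x m hm
  | add _ _ ihg ihh =>
    obtain ⟨C, hC, h⟩ := ihg
    obtain ⟨D, hD, h'⟩ := ihh
    refine ⟨C + D, by positivity, fun x hx => (norm_add_le _ _).trans ?_⟩
    rw [add_mul]
    exact add_le_add (h x hx) (h' x hx)
  | congr _ hgh ih =>
    obtain ⟨C, hC, h⟩ := ih
    refine ⟨C, hC, fun x hx => ?_⟩
    rw [hgh x (abs_pos.mp (hR.trans hx))]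
    exact h x hx

end LaurentJet

theorem pow_mul_le_sum_choose_mul {n m : ℕ} (hm : m ≤ n) {t : ℝ} (ht : 0 ≤ t) {u : ℕ → ℝ}
    (hu : ∀ i, 0 ≤ u i) :
    t ^ (n - m) * u m ≤ ∑ j ∈ Finset.range (n + 1), (n.choose j : ℝ) * t ^ j * u (n - j) := by
  have hmem : n - m ∈ Finset.range (n + 1) := Finset.mem_range.mpr (by omega)
  refine le_trans ?_ (Finset.single_le_sum (f := fun j => (n.choose j : ℝ) * t ^ j * u (n - j))
    (fun j _ => mul_nonneg (by positivity) (hu _)) hmem)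
  have hchoose : (1 : ℝ) ≤ n.choose (n - m) := mod_cast Nat.choose_pos (Nat.sub_le n m)
  simp only [Nat.sub_sub_self hm]
  exact mul_le_mul_of_nonneg_right (le_mul_of_one_le_left (by positivity) hchoose) (hu m)

/-- Pointwise estimate for iterates of the linear canonical Dunkl operator for `|x| > R`. -/
theorem stmt_10 (k a b c d : ℝ) (hk : -(1/2) ≤ k) (hM : a * d - b * c = 1) (hb : b ≠ 0)
    (f : ℝ → ℂ) (hf : ContDiff ℝ (⊤ : ℕ∞) f) (R : ℝ) (hR : 0 < R) (n : ℕ) :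
    ∃ C > (0 : ℝ), ∃ Cn0 > (0 : ℝ), ∃ P : ℕ → Polynomial ℝ,
      (∀ j ≤ n, (P j).natDegree ≤ j) ∧
      ∀ x : ℝ, R < |x| →
        ‖(lcdOp k a b)^[n] f x‖ ≤
          C * (∑ j ∈ Finset.range (n + 1),
                (n.choose j : ℝ) * |(P j).eval x| * ‖iteratedDeriv (n - j) f x‖ +
            Cn0 * ∑ i ∈ Finset.range n, ∑ j ∈ Finset.range (i + 1),
                (i.choose j : ℝ) * |(P j).eval x| * ‖iteratedDeriv (i - j) f x‖ +
            Cn0 * ∑ i ∈ Finset.range n, ∑ j ∈ Finset.range (i + 1),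
                (i.choose j : ℝ) * |(P j).eval (-x)| * ‖iteratedDeriv (i - j) f (-x)‖) := by
  have hjet := LaurentJet.lcdOp_iterate hf k a b n
  refine (hjet.exists_norm_le hR ?_ ?_).imp fun C hC =>
    ⟨hC.1, 1, one_pos, fun j => Polynomial.X ^ j, fun j _ => Polynomial.natDegree_X_pow_le j, hC.2⟩
  all_goals simp only [Polynomial.eval_pow, Polynomial.eval_X, abs_pow, abs_neg, one_mul]
  · intro x m hm
    have := pow_mul_le_sum_choose_mul hm (abs_nonneg x) fun i => norm_nonneg (iteratedDeriv i f x)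
    rw [add_assoc]
    exact this.trans (le_add_of_nonneg_right (by positivity))
  · intro x m hm
    have := pow_mul_le_sum_choose_mul (Nat.le_sub_one_of_lt hm) (abs_nonneg x)
      fun i => norm_nonneg (iteratedDeriv i f (-x))
    refine (this.trans ?_).trans (le_add_of_nonneg_left (by positivity))
    exact Finset.single_le_sum (f := fun i => ∑ j ∈ Finset.range (i + 1),
      (i.choose j : ℝ) * |x| ^ j * ‖iteratedDeriv (i - j) f (-x)‖)
      (fun i _ => by positivity) (Finset.mem_range.mpr (by omega))
end

section
/- For every f ∈ S(ℝ), every n ∈ ℕ, and every λ ∈ ℝ: D_k^M(Λ_{k,M⁻¹}ⁿ f)(λ) = (iλ/b)ⁿ · D_k^M f(λ). -/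
open MeasureTheory Filter Complex Topology
open scoped ENNReal

/-- The averages `x ↦ ∫₀¹ tᵐ φ(tx) dt`, whose derivatives are again of this form. -/
noncomputable def dilationAverage (m : ℕ) (φ : SchwartzMap ℝ ℂ) (x : ℝ) : ℂ :=
  ∫ t in (0 : ℝ)..1, (t ^ m) • φ (x * t)

theorem hasDerivAt_dilationAverage (m : ℕ) (φ : SchwartzMap ℝ ℂ) (x : ℝ) :
    HasDerivAt (dilationAverage m φ)
      (dilationAverage (m + 1) (SchwartzMap.derivCLM ℂ ℂ φ) x) x := by
  refine (intervalIntegral.hasDerivAt_integral_of_dominated_loc_of_deriv_le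
    (s := Set.univ) (bound := fun _ => SchwartzMap.seminorm ℂ 0 0 (SchwartzMap.derivCLM ℂ ℂ φ))
    (F' := fun x t => (t ^ (m + 1)) • (SchwartzMap.derivCLM ℂ ℂ φ) (x * t))
    Filter.univ_mem ?_ ?_ ?_ ?_ ?_ ?_).2
  · refine .of_forall fun y => Continuous.aestronglyMeasurable ?_
    have := φ.continuous
    fun_prop
  · refine Continuous.intervalIntegrable ?_ _ _
    have := φ.continuous
    fun_prop
  · refine Continuous.aestronglyMeasurable ?_
    have := (SchwartzMap.derivCLM ℂ ℂ φ).continuous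
    fun_prop
  · refine .of_forall fun t ht y _ => ?_
    rw [Set.uIoc_of_le zero_le_one] at ht
    rw [norm_smul, norm_pow, Real.norm_eq_abs, abs_of_pos ht.1]
    calc t ^ (m + 1) * ‖(SchwartzMap.derivCLM ℂ ℂ φ) (y * t)‖
        ≤ 1 * ‖(SchwartzMap.derivCLM ℂ ℂ φ) (y * t)‖ := by
          gcongr
          exact pow_le_one₀ ht.1.le ht.2
      _ ≤ _ := by
          rw [one_mul]
          exact SchwartzMap.norm_le_seminorm ℂ _ _
  · exact intervalIntegrable_const
  · refine .of_forall fun t _ y _ => ?_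
    have h := (φ.differentiableAt (x := y * t)).hasDerivAt.scomp y
      ((hasDerivAt_id y).mul_const t)
    have h2 := h.const_smul (t ^ m)
    simp only [one_mul, smul_smul, ← pow_succ] at h2
    exact h2

theorem iteratedDeriv_dilationAverage (m n : ℕ) (φ : SchwartzMap ℝ ℂ) :
    iteratedDeriv n (dilationAverage m φ) =
      dilationAverage (m + n) ((SchwartzMap.derivCLM ℂ ℂ)^[n] φ) := by
  induction n with
  | zero => simp
  | succ n ih =>
    rw [iteratedDeriv_succ, ih, Function.iterate_succ_apply', ← add_assoc]
    exact funext fun x => (hasDerivAt_dilationAverage _ _ x).deriv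

theorem contDiff_dilationAverage (m : ℕ) (φ : SchwartzMap ℝ ℂ) :
    ContDiff ℝ ((⊤ : ℕ∞) : WithTop ℕ∞) (dilationAverage m φ) := by
  refine contDiff_of_differentiable_iteratedDeriv fun n _ => ?_
  rw [iteratedDeriv_dilationAverage]
  exact fun x => (hasDerivAt_dilationAverage _ _ x).differentiableAt

theorem norm_dilationAverage_le (m : ℕ) (φ : SchwartzMap ℝ ℂ) (x : ℝ) :
    ‖dilationAverage m φ x‖ ≤ SchwartzMap.seminorm ℂ 0 0 φ := by
  refine (intervalIntegral.norm_integral_le_of_norm_le_const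
    (C := SchwartzMap.seminorm ℂ 0 0 φ) fun t ht => ?_).trans (by simp)
  rw [Set.uIoc_of_le zero_le_one] at ht
  rw [norm_smul, norm_pow, Real.norm_eq_abs, abs_of_pos ht.1]
  calc t ^ m * ‖φ (x * t)‖ ≤ 1 * ‖φ (x * t)‖ := by
        gcongr
        exact pow_le_one₀ ht.1.le ht.2
    _ ≤ _ := by
        rw [one_mul]
        exact SchwartzMap.norm_le_seminorm ℂ _ _

theorem mul_dilationAverage_deriv (φ : SchwartzMap ℝ ℂ) (h0 : φ 0 = 0) (x : ℝ) :
    (x : ℂ) * dilationAverage 0 (SchwartzMap.derivCLM ℂ ℂ φ) x = φ x := by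
  have h : ∫ t in (0 : ℝ)..1, x • (SchwartzMap.derivCLM ℂ ℂ φ) (x * t) = φ (x * 1) - φ (x * 0) := by
    refine intervalIntegral.integral_eq_sub_of_hasDerivAt (f := fun t => φ (x * t))
      (fun t _ => ?_) (Continuous.intervalIntegrable ?_ _ _)
    · have h := (φ.differentiableAt (x := x * t)).hasDerivAt.scomp t
        ((hasDerivAt_id t).const_mul x)
      simpa [Function.comp_def] using h
    · have := (SchwartzMap.derivCLM ℂ ℂ φ).continuous
      fun_prop
  rw [intervalIntegral.integral_smul, mul_one, mul_zero, h0, sub_zero, Complex.real_smul] at h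
  simpa only [dilationAverage, pow_zero, one_smul] using h

theorem iteratedDeriv_succ_eq_of_eq_mul {φ g : ℝ → ℂ}
    (hg : ContDiff ℝ ((⊤ : ℕ∞) : WithTop ℕ∞) g) (h : ∀ x : ℝ, (x : ℂ) * g x = φ x) (n : ℕ) :
    ∀ x : ℝ, iteratedDeriv (n + 1) φ x =
      (x : ℂ) * iteratedDeriv (n + 1) g x + (n + 1) * iteratedDeriv n g x := by
  have hd : ∀ (n : ℕ) (x : ℝ),
      HasDerivAt (iteratedDeriv n g) (iteratedDeriv (n + 1) g x) x := fun n x => by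
    rw [iteratedDeriv_succ]
    exact (hg.differentiable_iteratedDeriv n (by exact_mod_cast WithTop.coe_lt_top _) x).hasDerivAt
  have hx : ∀ x : ℝ, HasDerivAt (fun x : ℝ => (x : ℂ)) 1 x := fun x => by
    simpa using (hasDerivAt_id x).ofReal_comp
  induction n with
  | zero =>
    intro x
    rw [iteratedDeriv_succ, iteratedDeriv_zero, ← funext h]
    have := ((hx x).mul (hd 0 x)).deriv
    simp only [iteratedDeriv_zero] at this ⊢
    refine this.trans ?_
    simp
    ring
  | succ n ih =>
    intro x
    rw [iteratedDeriv_succ, funext ih]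
    refine (((hx x).mul (hd (n + 1) x)).add ((hd n x).const_mul ((n : ℂ) + 1))).deriv.trans ?_
    push_cast
    ring

/-- A Schwartz function vanishing at the origin is divisible by `x` in the Schwartz space. -/
theorem SchwartzMap.exists_mul_eq_of_apply_zero (φ : SchwartzMap ℝ ℂ) (h0 : φ 0 = 0) :
    ∃ g : SchwartzMap ℝ ℂ, ∀ x : ℝ, (x : ℂ) * g x = φ x := by
  set g : ℝ → ℂ := dilationAverage 0 (SchwartzMap.derivCLM ℂ ℂ φ) with hg
  have hsm := contDiff_dilationAverage 0 (SchwartzMap.derivCLM ℂ ℂ φ)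
  have hmul := mul_dilationAverage_deriv φ h0
  have hdec : ∀ p n : ℕ, ∃ C : ℝ, ∀ x : ℝ, ‖x‖ ^ p * ‖iteratedDeriv n g x‖ ≤ C := by
    intro p
    induction p with
    | zero =>
      intro n
      rw [hg, iteratedDeriv_dilationAverage]
      exact ⟨_, fun x => by simpa using norm_dilationAverage_le _ _ x⟩
    | succ p ih =>
      intro n
      rcases n with _ | n
      · refine ⟨SchwartzMap.seminorm ℂ p 0 φ, fun x => ?_⟩
        have := SchwartzMap.norm_pow_mul_le_seminorm ℂ φ p x
        rw [← hmul x, norm_mul, Complex.norm_real] at this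
        simpa [pow_succ, mul_assoc] using this
      · obtain ⟨C, hC⟩ := ih n
        refine ⟨SchwartzMap.seminorm ℂ p (n + 1) φ + (n + 1) * C, fun x => ?_⟩
        have h1 := SchwartzMap.le_seminorm' ℂ p (n + 1) φ x
        have h2 : (x : ℂ) * iteratedDeriv (n + 1) g x =
            iteratedDeriv (n + 1) φ x - (n + 1) * iteratedDeriv n g x := by
          rw [iteratedDeriv_succ_eq_of_eq_mul hsm hmul n x]
          ring
        have h3 : ‖x‖ * ‖iteratedDeriv (n + 1) g x‖ ≤
            ‖iteratedDeriv (n + 1) φ x‖ + (n + 1) * ‖iteratedDeriv n g x‖ := by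
          rw [← Complex.norm_real, ← norm_mul, h2]
          refine (norm_sub_le _ _).trans_eq ?_
          rw [norm_mul]
          congr 2
          exact_mod_cast Complex.norm_natCast (n + 1)
        calc ‖x‖ ^ (p + 1) * ‖iteratedDeriv (n + 1) g x‖
            = ‖x‖ ^ p * (‖x‖ * ‖iteratedDeriv (n + 1) g x‖) := by ring
          _ ≤ ‖x‖ ^ p * (‖iteratedDeriv (n + 1) φ x‖ + (n + 1) * ‖iteratedDeriv n g x‖) := by
              gcongr
          _ = ‖x‖ ^ p * ‖iteratedDeriv (n + 1) φ x‖ +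
              (n + 1) * (‖x‖ ^ p * ‖iteratedDeriv n g x‖) := by ring
          _ ≤ _ := by
              gcongr
              · simpa using h1
              · exact hC x
  refine ⟨⟨g, hsm, fun p n => ?_⟩, hmul⟩
  obtain ⟨C, hC⟩ := hdec p n
  exact ⟨C, fun x => by simpa [norm_iteratedFDeriv_eq_norm_iteratedDeriv] using hC x⟩

/-- The entire function `∑ (-1)ⁿ zⁿ / (n! Γ(n+k+1))`, in terms of which
`j_k(x) = Γ(k+1) besselSeries k (x²/4)`. -/
noncomputable def besselSeries (k z : ℝ) : ℝ :=
  ∑' n : ℕ, (-1 : ℝ) ^ n * z ^ n / ((n.factorial : ℝ) * Real.Gamma ((n : ℝ) + k + 1))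

theorem besselJ_eq (k x : ℝ) : besselJ k x = Real.Gamma (k + 1) * besselSeries k (x ^ 2 / 4) := by
  unfold besselJ besselSeries
  congr 1
  refine tsum_congr fun n => ?_
  rw [pow_mul, div_pow]
  norm_num

theorem Gamma_mul_half_pow_le {k : ℝ} (hk : -(1 / 2) ≤ k) (n : ℕ) :
    Real.Gamma (k + 1) * (1 / 2) ^ n ≤ Real.Gamma ((n : ℝ) + k + 1) := by
  induction n with
  | zero => simp
  | succ n ih =>
    have hn : (0 : ℝ) ≤ n := n.cast_nonneg
    have h : Real.Gamma (((n + 1 : ℕ) : ℝ) + k + 1) =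
        ((n : ℝ) + k + 1) * Real.Gamma ((n : ℝ) + k + 1) := by
      rw [← Real.Gamma_add_one (by linarith)]
      congr 1
      push_cast
      ring
    rw [h, pow_succ]
    have := Real.Gamma_pos_of_pos (show (0 : ℝ) < (n : ℝ) + k + 1 by linarith)
    nlinarith

theorem norm_besselSeries_term_le {k : ℝ} (hk : -(1 / 2) ≤ k) (n : ℕ) (z R : ℝ) (hz : |z| ≤ R) :
    ‖(-1 : ℝ) ^ n * z ^ n / ((n.factorial : ℝ) * Real.Gamma ((n : ℝ) + k + 1))‖ ≤
      (Real.Gamma (k + 1))⁻¹ * ((2 * R) ^ n / n.factorial) := by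
  have h0 : 0 < Real.Gamma (k + 1) := Real.Gamma_pos_of_pos (by linarith)
  have h1 := Gamma_mul_half_pow_le hk n
  have h2 : 0 < Real.Gamma (k + 1) * (1 / 2) ^ n := by positivity
  have h3 : 0 < Real.Gamma ((n : ℝ) + k + 1) := h2.trans_le h1
  have hf : (0 : ℝ) < n.factorial := by positivity
  have hR : 0 ≤ R := (abs_nonneg z).trans hz
  rw [norm_div, norm_mul, norm_pow, norm_pow, norm_neg, norm_one, one_pow, one_mul,
    Real.norm_eq_abs, Real.norm_eq_abs, abs_of_pos (mul_pos hf h3)]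
  calc |z| ^ n / (n.factorial * Real.Gamma ((n : ℝ) + k + 1))
      ≤ R ^ n / (n.factorial * (Real.Gamma (k + 1) * (1 / 2) ^ n)) := by gcongr
    _ = _ := by
      rw [mul_pow, one_div, inv_pow]
      field_simp

theorem summable_besselSeries {k : ℝ} (hk : -(1 / 2) ≤ k) (z : ℝ) :
    Summable fun n : ℕ =>
      (-1 : ℝ) ^ n * z ^ n / ((n.factorial : ℝ) * Real.Gamma ((n : ℝ) + k + 1)) :=
  .of_norm_bounded ((Real.summable_pow_div_factorial (2 * |z|)).mul_left _)
    fun n => norm_besselSeries_term_le hk n z _ le_rfl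

theorem hasDerivAt_besselSeries {k : ℝ} (hk : -(1 / 2) ≤ k) (z : ℝ) :
    HasDerivAt (besselSeries k) (-besselSeries (k + 1) z) z := by
  have hk1 : -(1 / 2) ≤ k + 1 := by linarith
  set R : ℝ := |z| + 1 with hR
  set g' : ℕ → ℝ → ℝ := fun n y =>
    (-1 : ℝ) ^ n * (n * y ^ (n - 1)) / ((n.factorial : ℝ) * Real.Gamma ((n : ℝ) + k + 1)) with hg'
  have hg'_zero : ∀ y, g' 0 y = 0 := fun y => by simp [hg']
  have hg'_succ : ∀ n y, g' (n + 1) y =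
      -((-1 : ℝ) ^ n * y ^ n / ((n.factorial : ℝ) * Real.Gamma ((n : ℝ) + (k + 1) + 1))) := by
    intro n y
    have h4 : ((n + 1 : ℕ) : ℝ) + k + 1 = (n : ℝ) + (k + 1) + 1 := by push_cast; ring
    simp only [hg', h4, Nat.factorial_succ, Nat.add_sub_cancel]
    have h3 : 0 < Real.Gamma ((n : ℝ) + (k + 1) + 1) :=
      Real.Gamma_pos_of_pos (by linarith [n.cast_nonneg (α := ℝ)])
    push_cast
    have h5 : (n : ℝ) + 1 ≠ 0 := by positivity
    have h6 : (n.factorial : ℝ) ≠ 0 := by positivity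
    field_simp
    ring
  have hs : Summable fun n : ℕ =>
      (Real.Gamma (k + 1 + 1))⁻¹ * ((2 * R) ^ (n - 1) / (n - 1).factorial) := by
    refine (summable_nat_add_iff 1).1 ?_
    simp only [Nat.add_sub_cancel]
    exact (Real.summable_pow_div_factorial (2 * R)).mul_left _
  have hbound : ∀ n y, y ∈ Metric.ball (0 : ℝ) R → ‖g' n y‖ ≤
      (Real.Gamma (k + 1 + 1))⁻¹ * ((2 * R) ^ (n - 1) / (n - 1).factorial) := by
    intro n y hy
    rcases n with _ | n
    · have := Real.Gamma_pos_of_pos (show 0 < k + 1 + 1 by linarith)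
      simp [hg'_zero, this.le]
    · rw [hg'_succ, norm_neg, Nat.add_sub_cancel]
      exact norm_besselSeries_term_le hk1 n y R (by simpa using (Metric.mem_ball.1 hy).le)
  have hmem : z ∈ Metric.ball (0 : ℝ) R := by simp [hR]
  have key := hasDerivAt_tsum_of_isPreconnected (g' := g') hs Metric.isOpen_ball
    (convex_ball (0 : ℝ) R).isPreconnected
    (fun n y _ => ((hasDerivAt_pow n y).const_mul ((-1 : ℝ) ^ n)).div_const _) hbound hmem
    (summable_besselSeries hk z) hmem
  refine key.congr_deriv ?_
  have hsum : Summable fun n => g' n z := by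
    refine (summable_nat_add_iff 1).1 ?_
    simp only [hg'_succ]
    exact (summable_besselSeries hk1 z).neg
  rw [hsum.tsum_eq_zero_add, hg'_zero, zero_add]
  simp only [hg'_succ]
  exact tsum_neg

theorem besselSeries_recurrence {k : ℝ} (hk : -(1 / 2) ≤ k) (z : ℝ) :
    besselSeries k z = (k + 1) * besselSeries (k + 1) z - z * besselSeries (k + 2) z := by
  have h0 := summable_besselSeries hk z
  have h1 := summable_besselSeries (show -(1 / 2) ≤ k + 1 by linarith) z
  have h2 := summable_besselSeries (show -(1 / 2) ≤ k + 2 by linarith) z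
  have hG : ∀ x : ℝ, 0 < x → Real.Gamma x ≠ 0 := fun x hx => (Real.Gamma_pos_of_pos hx).ne'
  have e : ∀ n : ℕ, (-1 : ℝ) ^ n * z ^ n / ((n.factorial : ℝ) * Real.Gamma ((n : ℝ) + k + 1)) -
      (k + 1) * ((-1 : ℝ) ^ n * z ^ n / ((n.factorial : ℝ) * Real.Gamma ((n : ℝ) + (k + 1) + 1))) =
      n * ((-1 : ℝ) ^ n * z ^ n / ((n.factorial : ℝ) * Real.Gamma ((n : ℝ) + (k + 1) + 1))) := by
    intro n
    have hn : (0 : ℝ) ≤ n := n.cast_nonneg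
    have hp : (0 : ℝ) < (n : ℝ) + k + 1 := by linarith
    rw [show (n : ℝ) + (k + 1) + 1 = (n : ℝ) + k + 1 + 1 by ring, Real.Gamma_add_one hp.ne']
    have h5 := hG _ hp
    have h6 : (n.factorial : ℝ) ≠ 0 := by positivity
    field_simp
    ring
  have hsub := h0.hasSum.sub (h1.hasSum.mul_left (k + 1))
  simp_rw [e] at hsub
  have hlast : HasSum (fun n : ℕ => (n : ℝ) *
      ((-1 : ℝ) ^ n * z ^ n / ((n.factorial : ℝ) * Real.Gamma ((n : ℝ) + (k + 1) + 1))))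
      (-z * besselSeries (k + 2) z) := by
    rw [← hasSum_nat_add_iff' 1]
    simp only [Finset.range_one, Finset.sum_singleton, Nat.cast_zero, zero_mul, sub_zero]
    refine (h2.hasSum.mul_left (-z)).congr_fun fun n => ?_
    have hn : (0 : ℝ) ≤ n := n.cast_nonneg
    rw [show ((n + 1 : ℕ) : ℝ) + (k + 1) + 1 = (n : ℝ) + (k + 2) + 1 by push_cast; ring,
      Nat.factorial_succ]
    have h5 := hG ((n : ℝ) + (k + 2) + 1) (by linarith)
    have h6 : (n.factorial : ℝ) ≠ 0 := by positivity
    push_cast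
    field_simp
    ring
  have := hsub.unique hlast
  unfold besselSeries at this ⊢
  linarith

theorem besselJ_neg (k x : ℝ) : besselJ k (-x) = besselJ k x := by
  rw [besselJ_eq, besselJ_eq, neg_sq]

theorem hasDerivAt_besselJ {k : ℝ} (hk : -(1 / 2) ≤ k) (y : ℝ) :
    HasDerivAt (besselJ k) (-(y * (besselJ (k + 1) y / (2 * (k + 1))))) y := by
  have hk1 : k + 1 ≠ 0 := by linarith
  rw [funext (besselJ_eq k)]
  refine (((hasDerivAt_besselSeries hk (y ^ 2 / 4)).comp y
    ((hasDerivAt_pow 2 y).div_const 4)).const_mul _).congr_deriv ?_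
  rw [besselJ_eq, Real.Gamma_add_one hk1]
  field_simp
  norm_num
  ring

theorem besselJ_recurrence {k : ℝ} (hk : -(1 / 2) ≤ k) (y : ℝ) :
    besselJ k y = besselJ (k + 1) y
      - y ^ 2 / (4 * (k + 1) * (k + 2)) * besselJ (k + 2) y := by
  have hk1 : k + 1 ≠ 0 := by linarith
  have hk2 : k + 2 ≠ 0 := by linarith
  rw [besselJ_eq, besselJ_eq, besselJ_eq, besselSeries_recurrence hk,
    show k + 2 + 1 = k + 1 + 1 + 1 by ring, Real.Gamma_add_one (by linarith : k + 1 + 1 ≠ 0),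
    Real.Gamma_add_one hk1]
  field_simp
  ring

theorem hasDerivAt_mul_besselJ {k : ℝ} (hk : -(1 / 2) ≤ k) (y : ℝ) :
    HasDerivAt (fun y => y * (besselJ (k + 1) y / (2 * (k + 1))))
      (besselJ k y - (2 * k + 1) * (besselJ (k + 1) y / (2 * (k + 1)))) y := by
  have hk1 : k + 1 ≠ 0 := by linarith
  have hk2 : k + 2 ≠ 0 := by linarith
  refine ((hasDerivAt_id y).mul
    ((hasDerivAt_besselJ (show -(1 / 2) ≤ k + 1 by linarith) y).div_const _)).congr_deriv ?_
  rw [besselJ_recurrence hk y, show k + 1 + 1 = k + 2 by ring]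
  simp only [id]
  field_simp
  ring

theorem besselJ_sq_add_sq_le {k : ℝ} (hk : -(1 / 2) ≤ k) (y : ℝ) :
    besselJ k y ^ 2 + (y * (besselJ (k + 1) y / (2 * (k + 1)))) ^ 2 ≤ besselJ k 0 ^ 2 := by
  set V : ℝ → ℝ := fun y => besselJ k y ^ 2 + (y * (besselJ (k + 1) y / (2 * (k + 1)))) ^ 2 with hV
  have hd : ∀ x, HasDerivAt V
      (-(2 * (2 * k + 1) * x * (besselJ (k + 1) x / (2 * (k + 1))) ^ 2)) x := fun x => by
    refine (((hasDerivAt_besselJ hk x).pow 2).add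
      ((hasDerivAt_mul_besselJ hk x).pow 2)).congr_deriv ?_
    push_cast
    ring
  have hanti : AntitoneOn V (Set.Ici 0) := by
    refine antitoneOn_of_deriv_nonpos (convex_Ici 0)
      (fun x _ => (hd x).continuousAt.continuousWithinAt)
      (fun x _ => (hd x).differentiableAt.differentiableWithinAt) fun x hx => ?_
    rw [interior_Ici] at hx
    rw [(hd x).deriv, neg_nonpos]
    have : 0 ≤ 2 * k + 1 := by linarith
    have : 0 ≤ x := le_of_lt hx
    positivity
  have heven : V |y| = V y := by
    rcases abs_choice y with h | h <;> simp [h, hV, besselJ_neg]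
  have := hanti Set.self_mem_Ici (abs_nonneg y) (abs_nonneg y)
  rw [heven] at this
  simpa [hV] using this

theorem dunklKernel_eq (k μ x : ℝ) : dunklKernel k μ x =
    (besselJ k (μ * x) : ℂ) +
      ((μ * x * (besselJ (k + 1) (μ * x) / (2 * (k + 1))) : ℝ) : ℂ) * I := by
  unfold dunklKernel
  push_cast
  ring

theorem norm_dunklKernel_le {k : ℝ} (hk : -(1 / 2) ≤ k) (μ x : ℝ) :
    ‖dunklKernel k μ x‖ ≤ |besselJ k 0| := by
  rw [← abs_norm, ← sq_le_sq, Complex.sq_norm, dunklKernel_eq, Complex.normSq_add_mul_I]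
  exact besselJ_sq_add_sq_le hk _

theorem exists_hasDerivAt_dunklKernel {k : ℝ} (hk : -(1 / 2) ≤ k) (μ x : ℝ) :
    ∃ E' : ℂ, HasDerivAt (dunklKernel k μ) E' x ∧
      x * E' = I * μ * x * dunklKernel k μ x -
        (2 * k + 1) * ((dunklKernel k μ x - dunklKernel k μ (-x)) / 2) := by
  have hm : HasDerivAt (fun x => μ * x) μ x := by simpa using (hasDerivAt_id x).const_mul μ
  have h := ((hasDerivAt_besselJ hk (μ * x)).comp x hm).ofReal_comp.add
    (((hasDerivAt_mul_besselJ hk (μ * x)).comp x hm).ofReal_comp.mul_const I)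
  refine ⟨_, h.congr_of_eventuallyEq (.of_forall fun x => dunklKernel_eq k μ x), ?_⟩
  rw [dunklKernel_eq, dunklKernel_eq, mul_neg, besselJ_neg, besselJ_neg]
  push_cast
  linear_combination (-(μ : ℂ) ^ 2 * x ^ 2 * (besselJ (k + 1) (μ * x) / (2 * (k + 1)))) * I_sq

theorem integrable_rpow_smul (s : ℝ) (hs : 0 ≤ s) (φ : SchwartzMap ℝ ℂ) :
    Integrable fun x : ℝ => |x| ^ s • φ x := by
  obtain ⟨m, hm⟩ := exists_nat_ge s
  have hint := (φ.integrable_pow_mul volume 0).add (φ.integrable_pow_mul volume m)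
  have hc := φ.continuous
  refine hint.mono' (Continuous.aestronglyMeasurable ?_) (.of_forall fun x => ?_)
  · exact (continuous_abs.rpow_const fun _ => .inr hs).smul hc
  · rw [norm_smul, Real.norm_of_nonneg (by positivity)]
    simp only [Pi.add_apply, pow_zero, Real.norm_eq_abs]
    rw [← add_mul]
    gcongr
    rcases le_total |x| 1 with h | h
    · exact (Real.rpow_le_one (abs_nonneg x) h hs).trans (by simp)
    · calc |x| ^ s ≤ |x| ^ (m : ℝ) := Real.rpow_le_rpow_of_exponent_le h hm
        _ = |x| ^ m := Real.rpow_natCast _ _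
        _ ≤ _ := by simp

theorem integrable_rpow_smul_mul (s : ℝ) (hs : 0 ≤ s) (φ : SchwartzMap ℝ ℂ) {K : ℝ → ℂ}
    (hK : Continuous K) {C : ℝ} (hC : ∀ x, ‖K x‖ ≤ C) :
    Integrable fun x : ℝ => |x| ^ s • (φ x * K x) := by
  simp_rw [← smul_mul_assoc]
  exact (integrable_rpow_smul s hs φ).mul_bdd (c := C) hK.aestronglyMeasurable (.of_forall hC)

theorem integral_muK (k : ℝ) (hk : -(1 / 2) ≤ k) (φ : ℝ → ℂ) :
    ∫ x, φ x ∂muK k =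
      (2 ^ (k + 1) * Real.Gamma (k + 1))⁻¹ • ∫ x : ℝ, |x| ^ (2 * k + 1) • φ x := by
  have hG := Real.Gamma_pos_of_pos (show 0 < k + 1 by linarith)
  rw [muK, integral_withDensity_eq_integral_toReal_smul (by fun_prop)
    (.of_forall fun _ => ENNReal.ofReal_lt_top), ← integral_smul]
  refine integral_congr_ae (.of_forall fun x => ?_)
  simp only
  rw [ENNReal.toReal_ofReal (by positivity), smul_smul, div_eq_inv_mul]

theorem integral_eq_integral_Ioi_add_neg {φ : ℝ → ℂ} (hφ : Integrable φ) :
    ∫ x, φ x = ∫ x in Set.Ioi (0 : ℝ), (φ x + φ (-x)) := by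
  have h : ∫ x in Set.Ioi (0 : ℝ), φ (-x) = ∫ x in Set.Iic (0 : ℝ), φ x := by
    simp
  rw [integral_add hφ.integrableOn hφ.comp_neg.integrableOn, h,
    ← integral_add_compl measurableSet_Ioi hφ, Set.compl_Ioi]

/-- Integration by parts for the operator `Λ_k + iαx` against a bounded kernel `K` which is an
eigenfunction of `Λ_k - iαx` with eigenvalue `iμ`. -/
theorem integral_mul_eigenkernel {k : ℝ} (hk : -(1 / 2) ≤ k) (α μ : ℝ)
    {f g h : SchwartzMap ℝ ℂ} (hg : ∀ x : ℝ, (x : ℂ) * g x = (f x - f (-x)) / 2)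
    (hh : ∀ x : ℝ, h x = deriv f x + (2 * k + 1) * g x + I * α * x * f x)
    {K K' : ℝ → ℂ} {C : ℝ} (hC : ∀ x, ‖K x‖ ≤ C) (hK : ∀ x, HasDerivAt K (K' x) x)
    (hK' : ∀ x : ℝ, x * K' x = (I * α * x + I * μ) * x * K x -
      (2 * k + 1) * ((K x - K (-x)) / 2)) :
    ∫ x, h x * K x ∂muK k = -(I * μ) * ∫ x, f x * K x ∂muK k := by
  have hs : 0 ≤ 2 * k + 1 := by linarith
  have hKc : Continuous K := continuous_iff_continuousAt.2 fun x => (hK x).continuousAt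
  have hfi := integrable_rpow_smul_mul _ hs f hKc hC
  have hhi := integrable_rpow_smul_mul _ hs h hKc hC
  set Ψ : ℝ → ℂ := fun x =>
    |x| ^ (2 * k + 1) • (h x * K x) + (I * μ) * |x| ^ (2 * k + 1) • (f x * K x) with hΨ
  have hΨi : Integrable Ψ := hhi.add (hfi.const_mul _)
  set Φ : ℝ → ℂ := fun x =>
    |x| ^ (2 * k + 1) • (f x * K x) - |-x| ^ (2 * k + 1) • (f (-x) * K (-x)) with hΦ
  have hΦi : Integrable Φ := hfi.sub hfi.comp_neg
  have hΦc : Continuous Φ := by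
    have h1 : Continuous fun x : ℝ => |x| ^ (2 * k + 1) • (f x * K x) :=
      (continuous_abs.rpow_const fun _ => .inr hs).smul (f.continuous.mul hKc)
    exact h1.sub (h1.comp continuous_neg)
  have hderiv : ∀ x ∈ Set.Ioi (0 : ℝ), HasDerivAt Φ (Ψ x + Ψ (-x)) x := by
    intro x hx
    have hx0 : (0 : ℝ) < x := hx
    have hfx : ∀ y, HasDerivAt f (deriv f y) y := fun y => f.differentiableAt.hasDerivAt
    have h1 := (hfx x).mul (hK x)
    have h2 := ((hfx (-x)).mul (hK (-x))).scomp x (hasDerivAt_neg x)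
    have h3 := (Real.hasDerivAt_rpow_const (p := 2 * k + 1) (.inl hx0.ne')).smul (h1.sub h2)
    have heq : Φ =ᶠ[𝓝 x] fun x => x ^ (2 * k + 1) •
        ((⇑f * K) x - ((⇑f * K) ∘ fun x => -x) x) := by
      filter_upwards [lt_mem_nhds hx0] with y hy
      simp only [hΦ, abs_neg, abs_of_pos hy, Pi.mul_apply, Function.comp_apply, smul_sub]
    refine (h3.congr_of_eventuallyEq heq).congr_deriv ?_
    rw [Real.rpow_sub_one hx0.ne']
    simp only [hΨ, abs_neg, abs_of_pos hx0, Pi.mul_apply, Function.comp_apply, hh,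
      Complex.real_smul, Pi.sub_apply]
    set P : ℂ := ((x ^ (2 * k + 1) : ℝ) : ℂ)
    have hxc : (x : ℂ) ≠ 0 := by exact_mod_cast hx0.ne'
    refine mul_left_cancel₀ hxc ?_
    have e1 := hK' x
    have e2 := hK' (-x)
    have e3 := hg x
    have e4 := hg (-x)
    rw [neg_neg] at e2 e4
    push_cast at e2 e4 ⊢
    field_simp
    linear_combination P * (f x * e1 - f (-x) * e2 - (2 * k + 1) * (K x * e3 - K (-x) * e4))
  have h0 : ∫ x, Ψ x = 0 := by
    rw [integral_eq_integral_Ioi_add_neg hΨi]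
    have hI : IntegrableOn (fun x => Ψ x + Ψ (-x)) (Set.Ioi 0) :=
      (hΨi.add hΨi.comp_neg).integrableOn
    rw [integral_Ioi_of_hasDerivAt_of_tendsto hΦc.continuousWithinAt hderiv hI
      (tendsto_zero_of_hasDerivAt_of_integrableOn_Ioi hderiv hI hΦi.integrableOn)]
    simp [hΦ]
  rw [hΨ, integral_add hhi (hfi.const_mul _), integral_const_mul] at h0
  rw [integral_muK k hk, integral_muK k hk, eq_neg_of_add_eq_zero_left h0, mul_smul_comm, neg_mul]

/-- The Schwartz space is stable under `Λ_{k,M⁻¹}`; here the image is described through the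
Schwartz quotient `g` of the odd part of `f` by `x`. -/
theorem exists_schwartz_lcdOp (k a b : ℝ) (f : SchwartzMap ℝ ℂ) :
    ∃ g h : SchwartzMap ℝ ℂ, (∀ x : ℝ, (x : ℂ) * g x = (f x - f (-x)) / 2) ∧
      (∀ x : ℝ, h x = deriv f x + (2 * k + 1) * g x + I * ((a / b : ℝ) : ℂ) * x * f x) ∧
      lcdOp k a b f = h := by
  have htg : (fun x : ℝ => (x : ℂ)).HasTemperateGrowth :=
    Complex.ofRealCLM.hasTemperateGrowth
  set φ : SchwartzMap ℝ ℂ := (1 / 2 : ℂ) •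
    (f - SchwartzMap.compCLMOfContinuousLinearEquiv ℂ (ContinuousLinearEquiv.neg ℝ) f) with hφ
  have hφx : ∀ x, φ x = (f x - f (-x)) / 2 := fun x => by
    simp [hφ]
    ring
  obtain ⟨g, hg⟩ := φ.exists_mul_eq_of_apply_zero (by simp [hφx])
  have hg' : ∀ x : ℝ, (x : ℂ) * g x = (f x - f (-x)) / 2 := fun x => (hg x).trans (hφx x)
  have hg0 : g 0 = deriv f 0 := by
    have h1 : HasDerivAt (fun x : ℝ => (x : ℂ) * g x) (g 0) 0 :=
      ((hasDerivAt_id (0 : ℝ)).ofReal_comp.mul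
        (g.differentiableAt (x := 0)).hasDerivAt).congr_deriv (by simp)
    have hf : ∀ y, HasDerivAt f (deriv f y) y := fun y => f.differentiableAt.hasDerivAt
    have h2 := ((hf 0).sub ((hf (-0)).scomp 0 (hasDerivAt_neg 0))).div_const 2
    rw [funext hg'] at h1
    refine (h1.unique h2).trans ?_
    simp
  refine ⟨g, SchwartzMap.derivCLM ℂ ℂ f + (2 * (k : ℂ) + 1) • g +
    (I * ((a / b : ℝ) : ℂ)) • SchwartzMap.smulLeftCLM ℂ (fun x : ℝ => (x : ℂ)) f, hg', ?_, ?_⟩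
  · intro x
    simp [SchwartzMap.smulLeftCLM_apply_apply htg]
    ring
  · funext x
    simp only [lcdOp, dunklOp, add_apply, smul_apply, smul_eq_mul,
      SchwartzMap.smulLeftCLM_apply_apply htg, SchwartzMap.derivCLM_apply]
    split_ifs with hx
    · subst hx
      rw [hg0]
      simp
      ring
    · have hxc : (x : ℂ) ≠ 0 := by exact_mod_cast hx
      rw [← hg' x]
      push_cast
      field_simp

theorem lcdt_lcdOp {k : ℝ} (hk : -(1 / 2) ≤ k) (a b d lam : ℝ) {f g h : SchwartzMap ℝ ℂ}
    (hg : ∀ x : ℝ, (x : ℂ) * g x = (f x - f (-x)) / 2)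
    (hh : ∀ x : ℝ, h x = deriv f x + (2 * k + 1) * g x + I * ((a / b : ℝ) : ℂ) * x * f x) :
    lcdt k a b d h lam = (I * lam / b) * lcdt k a b d f lam := by
  set e : ℝ → ℂ := fun x => Complex.exp
    (I / 2 * (((d / b : ℝ) : ℂ) * (lam : ℂ) ^ 2 + ((a / b : ℝ) : ℂ) * (x : ℂ) ^ 2)) with he
  have he_norm : ∀ x, ‖e x‖ = 1 := fun x => by
    simp only [he]
    rw [← Complex.norm_exp_ofReal_mul_I ((d / b * lam ^ 2 + a / b * x ^ 2) / 2)]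
    congr 2
    push_cast
    ring
  have he_deriv : ∀ x : ℝ, HasDerivAt e (e x * (I * ((a / b : ℝ) : ℂ) * x)) x := fun x => by
    have h1 : HasDerivAt (fun x : ℝ => (x : ℂ) ^ 2) (2 * x) x :=
      ((hasDerivAt_id x).ofReal_comp.pow 2).congr_deriv (by simp)
    refine (((h1.const_mul ((a / b : ℝ) : ℂ)).const_add _).const_mul (I / 2)).cexp.congr_deriv ?_
    rw [he]
    ring
  have he_neg : ∀ x, e (-x) = e x := fun x => by simp [he]
  choose E' hE hE' using exists_hasDerivAt_dunklKernel hk (-lam / b)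
  have key := integral_mul_eigenkernel hk (a / b) (-lam / b) hg hh
    (K := fun x => e x * dunklKernel k (-lam / b) x)
    (C := |besselJ k 0|)
    (fun x => by rw [norm_mul, he_norm, one_mul]; exact norm_dunklKernel_le hk _ x)
    (fun x => (he_deriv x).mul (hE x))
    (fun x => by
      rw [he_neg]
      linear_combination e x * hE' x)
  unfold lcdt
  simp only [mul_assoc] at key ⊢
  rw [he] at key
  rw [key]
  push_cast
  ring

/-- `D_k^M(Λ_{k,M⁻¹}ⁿ f)(λ) = (iλ/b)ⁿ D_k^M f(λ)` for `f ∈ S(ℝ)`. -/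
theorem stmt_12 (k a b c d : ℝ) (hk : -(1/2) ≤ k) (hM : a * d - b * c = 1) (hb : b ≠ 0)
    (f : SchwartzMap ℝ ℂ) (n : ℕ) (lam : ℝ) :
    lcdt k a b d ((lcdOp k a b)^[n] ⇑f) lam =
      (Complex.I * (lam : ℂ) / (b : ℂ)) ^ n * lcdt k a b d (⇑f) lam := by
  induction n generalizing f with
  | zero => simp
  | succ n ih =>
    obtain ⟨g, h, hg, hh, hop⟩ := exists_schwartz_lcdOp k a b f
    rw [Function.iterate_succ_apply, hop, ih, lcdt_lcdOp hk a b d lam hg hh, pow_succ, mul_assoc]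
end
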